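/- arXiv:2309.05522 — 4 statements merged into one kernel-verified Lean document; each statement's English description precedes it below -/
import Mathlib

section
/- Let p>1, m>0, let ρ ∈ A_m, and let {ρ_n} ⊂ A_m be a sequence such that the measures ρ_n ℒ^N converge to ρ ℒ^N in the weak* sense (i.e., ∫ φ ρ_n dx → ∫ φ ρ dx for every continuous compactly supported φ). Then lim_{n→∞} 𝒲_p(ρ_n) exists and equals 𝒲_p(ρ). -/
open MeasureTheory ENNReal Set Metric Filter

noncomputable section

/-- Euclidean space `ℝ^N`. -/
abbrev Euc (N : ℕ) := EuclideanSpace ℝ (Fin N)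

/-- The measure `ρ·γ` with density `ρ` with respect to `γ`. -/
def densM {α : Type*} [MeasurableSpace α] (γ : Measure α) (ρ : α → ℝ) : Measure α :=
  γ.withDensity fun x => ENNReal.ofReal (ρ x)

/-- `π` is a transport plan (coupling) with marginals `μ` and `ν`. -/
def IsCoupling {α : Type*} [MeasurableSpace α] (π : Measure (α × α)) (μ ν : Measure α) : Prop :=
  π.map Prod.fst = μ ∧ π.map Prod.snd = ν

/-- Transport cost `∬ d(x,y)^p dπ(x,y)`. -/
def tCost {α : Type*} [MeasurableSpace α] [Dist α] (p : ℝ) (π : Measure (α × α)) : ℝ≥0∞ :=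
  ∫⁻ z, ENNReal.ofReal (dist z.1 z.2 ^ p) ∂π

/-- The `p`-th power `W_p(μ,ν)^p` of the `p`-Wasserstein distance. -/
def WpPow {α : Type*} [MeasurableSpace α] [Dist α] (p : ℝ) (μ ν : Measure α) : ℝ≥0∞ :=
  ⨅ (π : Measure (α × α)) (_ : IsCoupling π μ ν), tCost p π

/-- The `p`-Wasserstein distance `W_p(μ,ν)`. -/
def Wp {α : Type*} [MeasurableSpace α] [Dist α] (p : ℝ) (μ ν : Measure α) : ℝ≥0∞ :=
  WpPow p μ ν ^ (1 / p)

/-- `ρ'` is an admissible competitor for the energy `𝒲_p(ρ)`: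
measurable, nonnegative, `ρ + ρ' ≤ 1` a.e., same total mass as `ρ`. -/
def Adm {α : Type*} [MeasurableSpace α] (γ : Measure α) (ρ ρ' : α → ℝ) : Prop :=
  Measurable ρ' ∧ (∀ x, 0 ≤ ρ' x) ∧ (∀ᵐ x ∂γ, ρ x + ρ' x ≤ 1) ∧
    ∫⁻ x, ENNReal.ofReal (ρ' x) ∂γ = ∫⁻ x, ENNReal.ofReal (ρ x) ∂γ

/-- The `p`-th power `𝒲_p(ρ)^p` of the Wasserstein energy of a density `ρ`. -/
def WEnergyPow {α : Type*} [MeasurableSpace α] [Dist α] (p : ℝ) (γ : Measure α) (ρ : α → ℝ) :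
    ℝ≥0∞ :=
  ⨅ (ρ' : α → ℝ) (_ : Adm γ ρ ρ'), WpPow p (densM γ ρ) (densM γ ρ')

/-- The Wasserstein energy `𝒲_p(ρ) = inf { W_p(ργ, ρ'γ) : ρ' admissible }`. -/
def WEnergy {α : Type*} [MeasurableSpace α] [Dist α] (p : ℝ) (γ : Measure α) (ρ : α → ℝ) :
    ℝ≥0∞ :=
  WEnergyPow p γ ρ ^ (1 / p)

/-- The class `A_m` of densities with values in `[0,1]` and total mass `m`. -/
def memA {α : Type*} [MeasurableSpace α] (γ : Measure α) (m : ℝ) (ρ : α → ℝ) : Prop :=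
  Measurable ρ ∧ (∀ᵐ x ∂γ, 0 ≤ ρ x ∧ ρ x ≤ 1) ∧ ∫ x, ρ x ∂γ = m

/-- The class `AP_ρ` of admissible plans: first marginal `ργ`, second marginal `≤ (1-ρ)γ`. -/
def AP {α : Type*} [MeasurableSpace α] (γ : Measure α) (ρ : α → ℝ) (π : Measure (α × α)) : Prop :=
  π.map Prod.fst = densM γ ρ ∧ π.map Prod.snd ≤ densM γ fun x => 1 - ρ x

/-- `z` belongs to the support of the measure `μ`. -/
def inSupport {α : Type*} [TopologicalSpace α] [MeasurableSpace α] (μ : Measure α) (z : α) :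
    Prop :=
  ∀ U : Set α, IsOpen U → z ∈ U → 0 < μ U


section helpers

lemma part_sum {β κ : Type*} [MeasurableSpace β] [Countable κ] (μ : Measure β) (q : β → κ)
    (hq : ∀ k, MeasurableSet (q ⁻¹' {k})) :
    Measure.sum (fun k => μ.restrict (q ⁻¹' {k})) = μ := by
  rw [← Measure.restrict_iUnion _ hq]
  · have : (⋃ k, q ⁻¹' {k}) = univ := by ext x; simp
    rw [this, Measure.restrict_univ]
  · intro i j hij
    simp only [Function.onFun]
    rw [Set.disjoint_left]
    intro x hx hy
    simp at hx hy
    exact hij (hx.symm.trans hy)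

lemma part_tsum {β κ : Type*} [MeasurableSpace β] [Countable κ] (μ : Measure β) (q : β → κ)
    (hq : ∀ k, MeasurableSet (q ⁻¹' {k})) :
    ∑' k, μ (q ⁻¹' {k}) = μ univ := by
  conv_rhs => rw [← part_sum μ q hq]
  rw [Measure.sum_apply _ MeasurableSet.univ]
  simp

set_option linter.unusedSectionVars false

variable {α ι : Type*} [MeasurableSpace α] [Countable ι]

def blk (μ ν : Measure α) (q : α → ι) (c : ι → ι → ℝ≥0∞) : Measure (α × α) :=
  Measure.sum fun i => Measure.sum fun j =>
    c i j • (μ.restrict (q ⁻¹' {i})).prod (ν.restrict (q ⁻¹' {j}))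

lemma blk_fst (μ ν : Measure α) [SFinite μ] [SFinite ν] (q : α → ι) (c : ι → ι → ℝ≥0∞) :
    (blk μ ν q c).map Prod.fst =
      Measure.sum fun i => (∑' j, c i j * ν (q ⁻¹' {j})) • μ.restrict (q ⁻¹' {i}) := by
  ext T hT
  rw [blk, Measure.map_apply measurable_fst hT, Measure.sum_apply _ (measurable_fst hT),
    Measure.sum_apply _ hT]
  congr 1; ext i
  rw [Measure.sum_apply _ (measurable_fst hT), Measure.smul_apply, smul_eq_mul,
    ← ENNReal.tsum_mul_right]
  congr 1; ext j
  rw [Measure.smul_apply, ← Measure.map_apply measurable_fst hT, Measure.map_fst_prod,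
    Measure.smul_apply]
  simp [mul_assoc]

lemma blk_snd (μ ν : Measure α) [SFinite μ] [SFinite ν] (q : α → ι) (c : ι → ι → ℝ≥0∞) :
    (blk μ ν q c).map Prod.snd =
      Measure.sum fun j => (∑' i, c i j * μ (q ⁻¹' {i})) • ν.restrict (q ⁻¹' {j}) := by
  ext T hT
  rw [blk, Measure.map_apply measurable_snd hT, Measure.sum_apply _ (measurable_snd hT),
    Measure.sum_apply _ hT]
  simp_rw [Measure.sum_apply _ (measurable_snd hT)]
  rw [ENNReal.tsum_comm]
  congr 1; ext i
  rw [Measure.smul_apply, smul_eq_mul, ← ENNReal.tsum_mul_right]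
  congr 1; ext j
  rw [Measure.smul_apply, ← Measure.map_apply measurable_snd hT, Measure.map_snd_prod,
    Measure.smul_apply]
  simp [mul_assoc]

lemma sum_smul_le (μ : Measure α) (q : α → ι) (hq : ∀ k, MeasurableSet (q ⁻¹' {k}))
    (a : ι → ℝ≥0∞) (ha : ∀ i, a i ≤ 1) :
    (Measure.sum fun i => a i • μ.restrict (q ⁻¹' {i})) ≤ μ := by
  conv_rhs => rw [← part_sum μ q hq]
  rw [Measure.le_iff]
  intro T hT
  rw [Measure.sum_apply _ hT, Measure.sum_apply _ hT]
  refine ENNReal.tsum_le_tsum fun i => ?_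
  rw [Measure.smul_apply, smul_eq_mul]
  exact mul_le_of_le_one_left' (ha i)

lemma blk_cost [Dist α] (p : ℝ) (μ ν : Measure α) [SFinite μ] [SFinite ν] (q : α → ι)
    (hq : ∀ k, MeasurableSet (q ⁻¹' {k})) (c K : ι → ι → ℝ≥0∞)
    (hK : ∀ x y, ENNReal.ofReal (dist x y ^ p) ≤ K (q x) (q y)) :
    tCost p (blk μ ν q c) ≤
      ∑' i, ∑' j, c i j * (μ (q ⁻¹' {i}) * ν (q ⁻¹' {j})) * K i j := by
  rw [tCost, blk, lintegral_sum_measure]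
  refine ENNReal.tsum_le_tsum fun i => ?_
  rw [lintegral_sum_measure]
  refine ENNReal.tsum_le_tsum fun j => ?_
  rw [lintegral_smul_measure, smul_eq_mul, mul_assoc]
  gcongr
  rw [Measure.prod_restrict]
  calc _ ≤ ∫⁻ z in (q ⁻¹' {i}) ×ˢ (q ⁻¹' {j}), K i j ∂(μ.prod ν) := by
        apply setLIntegral_mono' ((hq i).prod (hq j))
        rintro ⟨x, y⟩ ⟨hx, hy⟩
        simp at hx hy
        subst hx; subst hy
        exact hK x y
    _ = _ := by
        rw [setLIntegral_const, Measure.prod_prod, mul_comm]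

lemma blk_univ (μ ν : Measure α) [SFinite μ] [SFinite ν] (q : α → ι) (c : ι → ι → ℝ≥0∞) :
    blk μ ν q c univ = ∑' i, ∑' j, c i j * (μ (q ⁻¹' {i}) * ν (q ⁻¹' {j})) := by
  rw [blk, Measure.sum_apply _ MeasurableSet.univ]
  congr 1; ext i
  rw [Measure.sum_apply _ MeasurableSet.univ]
  congr 1; ext j
  rw [Measure.smul_apply, ← univ_prod_univ, Measure.prod_prod]
  simp

lemma inv_max_mul_le (r s : ℝ≥0∞) : (max r s)⁻¹ * r ≤ 1 :=
  (mul_le_mul_right (le_max_left r s) _).trans (ENNReal.inv_mul_le_one _)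

lemma def_le (r s : ℝ≥0∞) (hr : r ≠ ⊤) (hs : s ≠ ⊤) :
    r * (1 - (max r s)⁻¹ * s) ≤ r - s := by
  rcases le_total r s with h | h
  · rw [max_eq_right h]
    rcases eq_or_ne s 0 with rfl | h0
    · simp at h; simp [h]
    · rw [ENNReal.inv_mul_cancel h0 hs]; simp
  · rw [max_eq_left h]
    rcases eq_or_ne r 0 with rfl | h0
    · simp
    · rw [ENNReal.mul_sub (fun _ _ => hr), ← mul_assoc, ENNReal.mul_inv_cancel h0 hr]; simp

lemma one_le_aux (x y : ℝ≥0∞) (hx : x ≤ 1) (hy : y ≤ 1) : 1 ≤ x * y + (1 - x) + (1 - y) := by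
  calc (1:ℝ≥0∞) = y + (1 - y) := (add_tsub_cancel_of_le hy).symm
    _ = (x + (1 - x)) * y + (1 - y) := by rw [add_tsub_cancel_of_le hx, one_mul]
    _ ≤ _ := by
      rw [add_mul]
      gcongr
      exact mul_le_of_le_one_right' hy

/-- discretised transfer of plans -/
lemma transfer [PseudoMetricSpace α] (p : ℝ) (hp : 1 < p)
    (μ ν μ' ν' : Measure α) [SFinite μ'] [SFinite ν'] (q : α → ι)
    (hq : ∀ k, MeasurableSet (q ⁻¹' {k})) (d : ℝ) (hd : 0 ≤ d)
    (hqd : ∀ x y, q x = q y → dist x y ≤ d)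
    (hμ : ∀ k, μ (q ⁻¹' {k}) ≠ ⊤) (hν : ∀ k, ν (q ⁻¹' {k}) ≠ ⊤)
    (hμ' : ∀ k, μ' (q ⁻¹' {k}) ≠ ⊤) (hν' : ∀ k, ν' (q ⁻¹' {k}) ≠ ⊤)
    (π : Measure (α × α)) (h1 : π.map Prod.fst = μ) (h2 : π.map Prod.snd ≤ ν) :
    ∃ π' : Measure (α × α), π'.map Prod.fst ≤ μ' ∧ π'.map Prod.snd ≤ ν' ∧
      π univ ≤ π' univ + ((∑' i, (μ (q ⁻¹' {i}) - μ' (q ⁻¹' {i}))) +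
        ∑' i, (ν (q ⁻¹' {i}) - ν' (q ⁻¹' {i}))) ∧
      tCost p π' ≤ ∫⁻ z, (ENNReal.ofReal (dist z.1 z.2) + ENNReal.ofReal (2 * d)) ^ p ∂π := by
  let P : ι → ι → ℝ≥0∞ := fun i j => π ((q ⁻¹' {i}) ×ˢ (q ⁻¹' {j}))
  let u : ι → ℝ≥0∞ := fun i => (max (μ (q ⁻¹' {i})) (μ' (q ⁻¹' {i})))⁻¹
  let w : ι → ℝ≥0∞ := fun i => (max (ν (q ⁻¹' {i})) (ν' (q ⁻¹' {i})))⁻¹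
  let c : ι → ι → ℝ≥0∞ := fun i j => P i j * u i * w j
  have hus : ∀ i, u i * μ' (q ⁻¹' {i}) ≤ 1 := fun i => by
    simp only [u]; rw [max_comm]; exact inv_max_mul_le _ _
  have hws : ∀ i, w i * ν' (q ⁻¹' {i}) ≤ 1 := fun i => by
    simp only [w]; rw [max_comm]; exact inv_max_mul_le _ _
  have hPi : ∀ i, ∑' j, P i j = μ (q ⁻¹' {i}) := fun i => by
    rw [← h1, Measure.map_apply measurable_fst (hq i)]
    have := part_tsum (π.restrict (Prod.fst ⁻¹' (q ⁻¹' {i}))) (fun z => q z.2)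
      (fun k => measurable_snd (hq k))
    rw [Measure.restrict_apply_univ] at this
    rw [← this]
    congr 1; ext j
    refine Eq.trans ?_ (Measure.restrict_apply (measurable_snd (hq j))).symm
    simp only [P]
    congr 1; ext z; simp [and_comm]
  have hPj : ∀ j, ∑' i, P i j ≤ ν (q ⁻¹' {j}) := fun j => by
    refine le_trans (le_of_eq ?_) (h2 _)
    rw [Measure.map_apply measurable_snd (hq j)]
    have := part_tsum (π.restrict (Prod.snd ⁻¹' (q ⁻¹' {j}))) (fun z => q z.1)
      (fun k => measurable_fst (hq k))
    rw [Measure.restrict_apply_univ] at this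
    rw [← this]
    congr 1; ext i
    exact (Measure.restrict_apply (measurable_fst (hq i))).symm
  refine ⟨blk μ' ν' q c, ?_, ?_, ?_, ?_⟩
  · rw [blk_fst]
    apply sum_smul_le _ _ hq
    intro i
    calc ∑' j, c i j * ν' (q ⁻¹' {j}) ≤ ∑' j, u i * P i j := by
          refine ENNReal.tsum_le_tsum fun j => ?_
          calc c i j * ν' (q ⁻¹' {j}) = u i * P i j * (w j * ν' (q ⁻¹' {j})) := by
                simp only [c]; ring
            _ ≤ _ := mul_le_of_le_one_right' (hws j)
      _ = u i * μ (q ⁻¹' {i}) := by rw [ENNReal.tsum_mul_left, hPi]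
      _ ≤ 1 := inv_max_mul_le _ _
  · rw [blk_snd]
    apply sum_smul_le _ _ hq
    intro j
    calc ∑' i, c i j * μ' (q ⁻¹' {i}) ≤ ∑' i, w j * P i j := by
          refine ENNReal.tsum_le_tsum fun i => ?_
          calc c i j * μ' (q ⁻¹' {i}) = w j * P i j * (u i * μ' (q ⁻¹' {i})) := by
                simp only [c]; ring
            _ ≤ _ := mul_le_of_le_one_right' (hus i)
      _ ≤ w j * ν (q ⁻¹' {j}) := by rw [ENNReal.tsum_mul_left]; gcongr; exact hPj j
      _ ≤ 1 := inv_max_mul_le _ _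
  · have hU : π univ = ∑' i, ∑' j, P i j := by
      simp_rw [hPi]
      rw [part_tsum μ q hq, ← h1, Measure.map_apply measurable_fst MeasurableSet.univ]; simp
    rw [hU, blk_univ]
    have e1 : ∑' i, ∑' j, P i j * (1 - u i * μ' (q ⁻¹' {i})) ≤
        ∑' i, (μ (q ⁻¹' {i}) - μ' (q ⁻¹' {i})) := by
      refine ENNReal.tsum_le_tsum fun i => ?_
      rw [ENNReal.tsum_mul_right, hPi]
      exact def_le _ _ (hμ i) (hμ' i)
    have e2 : ∑' i, ∑' j, P i j * (1 - w j * ν' (q ⁻¹' {j})) ≤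
        ∑' i, (ν (q ⁻¹' {i}) - ν' (q ⁻¹' {i})) := by
      rw [ENNReal.tsum_comm]
      refine ENNReal.tsum_le_tsum fun i => ?_
      rw [ENNReal.tsum_mul_right]
      refine le_trans ?_ (def_le _ _ (hν i) (hν' i))
      gcongr
      exact hPj i
    refine le_trans ?_ (add_le_add_right (add_le_add e1 e2) _)
    rw [← ENNReal.tsum_add, ← ENNReal.tsum_add]
    refine ENNReal.tsum_le_tsum fun i => ?_
    rw [← ENNReal.tsum_add, ← ENNReal.tsum_add]
    refine ENNReal.tsum_le_tsum fun j => ?_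
    calc P i j = P i j * 1 := (mul_one _).symm
      _ ≤ P i j * (_ + _ + _) := mul_le_mul_right (one_le_aux _ _ (hus i) (hws j)) _
      _ = _ := by simp only [c]; ring
  · let K : ι → ι → ℝ≥0∞ := fun i j => ⨆ (x : α) (y : α) (_ : q x = i ∧ q y = j),
      ENNReal.ofReal (dist x y ^ p)
    refine (blk_cost p μ' ν' q hq c K ?_).trans ?_
    · intro x y
      refine le_trans ?_ (le_iSup _ x)
      refine le_trans ?_ (le_iSup _ y)
      exact le_iSup_of_le ⟨rfl, rfl⟩ le_rfl
    · have key : ∀ i j, P i j * K i j ≤ ∫⁻ z in (q ⁻¹' {i}) ×ˢ (q ⁻¹' {j}),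
          (ENNReal.ofReal (dist z.1 z.2) + ENNReal.ofReal (2 * d)) ^ p ∂π := by
        intro i j
        rw [mul_comm, ← setLIntegral_const]
        apply setLIntegral_mono' ((hq i).prod (hq j))
        rintro ⟨x, y⟩ ⟨hx, hy⟩
        simp only [mem_preimage, mem_singleton_iff] at hx hy
        refine iSup_le fun x' => iSup_le fun y' => iSup_le fun h => ?_
        rw [← ENNReal.ofReal_rpow_of_nonneg dist_nonneg (by linarith),
          ← ENNReal.ofReal_add dist_nonneg (by linarith)]
        gcongr
        have a1 := hqd x' x (h.1.trans hx.symm)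
        have a2 := hqd y y' (hy.trans h.2.symm)
        have := dist_triangle4 x' x y y'
        linarith
      have tot : ∫⁻ z, (ENNReal.ofReal (dist z.1 z.2) + ENNReal.ofReal (2 * d)) ^ p ∂π =
          ∑' i, ∑' j, ∫⁻ z in (q ⁻¹' {i}) ×ˢ (q ⁻¹' {j}),
          (ENNReal.ofReal (dist z.1 z.2) + ENNReal.ofReal (2 * d)) ^ p ∂π := by
        conv_lhs => rw [← part_sum π (fun z => (q z.1, q z.2)) (fun k => by
          have : (fun z : α × α => (q z.1, q z.2)) ⁻¹' {k} =
            (q ⁻¹' {k.1}) ×ˢ (q ⁻¹' {k.2}) := by ext z; simp [Prod.ext_iff]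
          rw [this]; exact (hq _).prod (hq _))]
        rw [lintegral_sum_measure, ENNReal.tsum_prod']
        congr 1; ext i; congr 1; ext j
        congr 2
        ext z; simp [Prod.ext_iff]
      rw [tot]
      refine ENNReal.tsum_le_tsum fun i => ENNReal.tsum_le_tsum fun j => ?_
      refine le_trans ?_ (key i j)
      gcongr
      calc c i j * (μ' (q ⁻¹' {i}) * ν' (q ⁻¹' {j})) =
          P i j * ((u i * μ' (q ⁻¹' {i})) * (w j * ν' (q ⁻¹' {j}))) := by
            simp only [c]; ring
        _ ≤ P i j := mul_le_of_le_one_right' (mul_le_one' (hus i) (hws j))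

/-- completion of a partial plan -/
lemma complete [PseudoMetricSpace α] (p : ℝ) (hp : 1 < p)
    (μ ν : Measure α) [IsFiniteMeasure μ] [SigmaFinite ν] (q : α → ι)
    (hq : ∀ k, MeasurableSet (q ⁻¹' {k})) (D : ℝ)
    (hqd : ∀ x y, q x = q y → dist x y ≤ D)
    (hν : ∀ k, ν (q ⁻¹' {k}) ≠ ⊤)
    (hνμ : ∀ k, 2 * μ univ ≤ ν (q ⁻¹' {k}))
    (π₁ : Measure (α × α)) (h1 : π₁.map Prod.fst ≤ μ) (h2 : π₁.map Prod.snd ≤ ν) :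
    ∃ π : Measure (α × α), π.map Prod.fst = μ ∧ π.map Prod.snd ≤ ν ∧
      tCost p π ≤ tCost p π₁ + ENNReal.ofReal (D ^ p) * (μ univ - π₁ univ) := by
  rcases eq_or_ne (μ univ) 0 with hz | hz
  · have hμ0 : μ = 0 := Measure.measure_univ_eq_zero.1 hz
    subst hμ0
    exact ⟨π₁, le_antisymm h1 (Measure.zero_le _), h2, le_self_add⟩
  have hu : π₁ univ ≤ μ univ := by
    have := h1 univ
    rwa [Measure.map_apply measurable_fst MeasurableSet.univ, preimage_univ] at this
  have : IsFiniteMeasure π₁ := ⟨hu.trans_lt (measure_lt_top μ _)⟩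
  have hsu : ∀ T, π₁.map Prod.snd T ≤ μ univ := fun T => by
    refine (measure_mono (subset_univ _)).trans ?_
    rwa [Measure.map_apply measurable_snd MeasurableSet.univ, preimage_univ]
  set e := μ - π₁.map Prod.fst with he
  set f := ν - π₁.map Prod.snd with hf
  have hfle : f ≤ ν := Measure.sub_le
  have hele : e ≤ μ := Measure.sub_le
  have he' : e + π₁.map Prod.fst = μ := Measure.sub_add_cancel_of_le h1
  have hf' : f + π₁.map Prod.snd = ν := Measure.sub_add_cancel_of_le h2
  have : IsFiniteMeasure e := isFiniteMeasure_of_le μ hele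
  have : SigmaFinite f := Measure.sigmaFinite_of_le ν hfle
  have hfk : ∀ k, μ univ ≤ f (q ⁻¹' {k}) := fun k => by
    have h := hνμ k
    rw [← hf', Measure.add_apply, two_mul] at h
    exact ENNReal.le_of_add_le_add_right (measure_ne_top μ _)
      (h.trans (add_le_add_right (hsu _) _))
  have hf0 : ∀ k, f (q ⁻¹' {k}) ≠ 0 := fun k h => hz (le_antisymm (h ▸ hfk k) zero_le)
  have hft : ∀ k, f (q ⁻¹' {k}) ≠ ⊤ := fun k => ne_top_of_le_ne_top (hν k) (hfle _)
  classical
  let c : ι → ι → ℝ≥0∞ := fun i j => if j = i then (f (q ⁻¹' {i}))⁻¹ else 0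
  have hc1 : ∀ i, ∑' j, c i j * f (q ⁻¹' {j}) = 1 := fun i => by
    rw [tsum_eq_single i]
    · simp [c, ENNReal.inv_mul_cancel (hf0 i) (hft i)]
    · intro j hj; simp [c, hj]
  have hc2 : ∀ j, ∑' i, c i j * e (q ⁻¹' {i}) ≤ 1 := fun j => by
    rw [tsum_eq_single j]
    · simp only [c, if_true]
      refine le_trans ?_ (ENNReal.inv_mul_le_one (f (q ⁻¹' {j})))
      refine mul_le_mul_right ?_ _
      exact ((hele _).trans (measure_mono (subset_univ _))).trans (hfk j)
    · intro i hi; simp [c, Ne.symm hi]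
  have hF : (blk e f q c).map Prod.fst = e := by
    rw [blk_fst]
    simp_rw [hc1, one_smul]
    exact part_sum e q hq
  have hS : (blk e f q c).map Prod.snd ≤ f := by
    rw [blk_snd]
    exact sum_smul_le _ _ hq _ hc2
  refine ⟨π₁ + blk e f q c, ?_, ?_, ?_⟩
  · rw [Measure.map_add _ _ measurable_fst, hF, add_comm, he']
  · rw [Measure.map_add _ _ measurable_snd]
    conv_rhs => rw [← hf', add_comm]
    gcongr
  · have : tCost p (π₁ + blk e f q c) = tCost p π₁ + tCost p (blk e f q c) := by
      simp [tCost, lintegral_add_measure]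
    rw [this]
    gcongr
    let K : ι → ι → ℝ≥0∞ := fun i j => if j = i then ENNReal.ofReal (D ^ p) else ⊤
    refine (blk_cost p e f q hq c K ?_).trans ?_
    · intro x y
      simp only [K]
      split_ifs with h
      · apply ENNReal.ofReal_le_ofReal
        exact Real.rpow_le_rpow dist_nonneg (hqd _ _ h.symm) (by linarith)
      · exact le_top
    · have heu : e univ = μ univ - π₁ univ := by
        rw [← he', Measure.add_apply, Measure.map_apply measurable_fst MeasurableSet.univ,
          preimage_univ, ENNReal.add_sub_cancel_right (measure_ne_top _ _)]
      rw [← heu, ← part_tsum e q hq, ← ENNReal.tsum_mul_left]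
      refine ENNReal.tsum_le_tsum fun i => ?_
      rw [tsum_eq_single i]
      · simp only [c, K, if_true]
        rw [mul_comm (e _), ← mul_assoc, ENNReal.inv_mul_cancel (hf0 i) (hft i), one_mul, mul_comm]
      · intro j hj; simp [c, hj]

end helpers

section energy

variable {α : Type*} [MeasurableSpace α]

lemma densM_add (γ : Measure α) (σ : α → ℝ) (hσ : Measurable σ)
    (h01 : ∀ᵐ x ∂γ, 0 ≤ σ x ∧ σ x ≤ 1) :
    densM γ σ + densM γ (fun x => 1 - σ x) = γ := by
  rw [densM, densM, ← withDensity_add_left (by fun_prop)]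
  conv_rhs => rw [← withDensity_one (μ := γ)]
  apply withDensity_congr_ae
  filter_upwards [h01] with x hx
  simp only [Pi.add_apply, Pi.one_apply]
  rw [← ENNReal.ofReal_add hx.1 (by linarith)]
  simp

lemma densM_univ (γ : Measure α) (m : ℝ) (hm : 0 < m) (σ : α → ℝ) (h : memA γ m σ) :
    densM γ σ univ = ENNReal.ofReal m := by
  obtain ⟨h1, h2, h3⟩ := h
  have hi : Integrable σ γ := by
    by_contra hc
    rw [integral_undef hc] at h3
    linarith
  rw [densM, withDensity_apply _ MeasurableSet.univ, Measure.restrict_univ, ← h3,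
    ofReal_integral_eq_lintegral_ofReal hi (h2.mono fun x hx => hx.1)]

lemma plan_le [Dist α] (p : ℝ) (γ : Measure α) [SigmaFinite γ] (m : ℝ) (hm : 0 < m) (σ : α → ℝ)
    (h : memA γ m σ) (π : Measure (α × α)) (hπ : AP γ σ π) :
    WEnergyPow p γ σ ≤ tCost p π := by
  obtain ⟨h1, h2⟩ := hπ
  have hU : π univ = ENNReal.ofReal m := by
    rw [← densM_univ γ m hm σ h, ← h1, Measure.map_apply measurable_fst MeasurableSet.univ,
      preimage_univ]
  have : IsFiniteMeasure π := ⟨by rw [hU]; exact ENNReal.ofReal_lt_top⟩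
  set s := π.map Prod.snd with hs
  have hac : s ≪ γ := (Measure.absolutelyContinuous_of_le h2).trans
    (withDensity_absolutelyContinuous _ _)
  have hds : densM γ (fun x => (s.rnDeriv γ x).toReal) = s := by
    conv_rhs => rw [← Measure.withDensity_rnDeriv_eq s γ hac]
    apply withDensity_congr_ae
    filter_upwards [Measure.rnDeriv_lt_top s γ] with x hx
    exact ENNReal.ofReal_toReal hx.ne
  have hle : s.rnDeriv γ ≤ᵐ[γ] fun x => ENNReal.ofReal (1 - σ x) := by
    apply ae_le_of_forall_setLIntegral_le_of_sigmaFinite (Measure.measurable_rnDeriv _ _)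
    intro T hT _
    rw [Measure.setLIntegral_rnDeriv hac, ← withDensity_apply _ hT]
    exact h2 T
  have hadm : Adm γ σ (fun x => (s.rnDeriv γ x).toReal) := by
    refine ⟨(Measure.measurable_rnDeriv _ _).ennreal_toReal, fun x => ENNReal.toReal_nonneg, ?_, ?_⟩
    · filter_upwards [hle, h.2.1] with x hx h01
      have := ENNReal.toReal_mono ENNReal.ofReal_ne_top hx
      rw [ENNReal.toReal_ofReal (by linarith)] at this
      linarith
    · have e1 : densM γ (fun x => (s.rnDeriv γ x).toReal) univ = densM γ σ univ := by
        rw [hds, densM_univ γ m hm σ h, hs, Measure.map_apply measurable_snd MeasurableSet.univ,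
          preimage_univ, hU]
      simpa [densM] using e1
  refine iInf₂_le_of_le _ hadm ?_
  exact iInf₂_le_of_le π ⟨h1, by rw [hds]⟩ le_rfl

lemma adm_AP (γ : Measure α) (σ ρ' : α → ℝ) (hadm : Adm γ σ ρ')
    (π : Measure (α × α)) (hπ : IsCoupling π (densM γ σ) (densM γ ρ')) : AP γ σ π := by
  refine ⟨hπ.1, ?_⟩
  rw [hπ.2]
  apply withDensity_mono
  filter_upwards [hadm.2.2.1] with x hx
  exact ENNReal.ofReal_le_ofReal (by linarith)

lemma rp_iff {p : ℝ} (hp : 0 < p) {x y : ℝ≥0∞} : x ≤ y ^ (1 / p) ↔ x ^ p ≤ y := by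
  rw [one_div]; exact ENNReal.le_rpow_inv_iff hp

lemma energy_le {ι κ : Type*} [Countable ι] [Countable κ]
    [PseudoMetricSpace α] [OpensMeasurableSpace α] [SecondCountableTopology α]
    (p : ℝ) (hp : 1 < p) (γ : Measure α) [SigmaFinite γ] (m : ℝ) (hm : 0 < m)
    (ρ σ : α → ℝ) (hρ : memA γ m ρ) (hσ : memA γ m σ)
    (q : α → ι) (hq : ∀ k, MeasurableSet (q ⁻¹' {k})) (d : ℝ) (hd : 0 ≤ d)
    (hqd : ∀ x y, q x = q y → dist x y ≤ d) (hqf : ∀ k, γ (q ⁻¹' {k}) ≠ ⊤)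
    (Q : α → κ) (hQ : ∀ k, MeasurableSet (Q ⁻¹' {k})) (D : ℝ)
    (hQd : ∀ x y, Q x = Q y → dist x y ≤ D) (hQf : ∀ k, γ (Q ⁻¹' {k}) ≠ ⊤)
    (hQm : ∀ k, ENNReal.ofReal (3 * m) ≤ γ (Q ⁻¹' {k})) :
    WEnergyPow p γ σ ≤ ENNReal.ofReal (D ^ p) * ENNReal.ofReal m ∧
    WEnergy p γ σ ≤ WEnergy p γ ρ + (ENNReal.ofReal (2 * d) * ENNReal.ofReal m ^ (1 / p) +
      (ENNReal.ofReal (D ^ p) *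
        ((∑' i, (densM γ ρ (q ⁻¹' {i}) - densM γ σ (q ⁻¹' {i}))) +
          ∑' i, (densM γ σ (q ⁻¹' {i}) - densM γ ρ (q ⁻¹' {i})))) ^ (1 / p)) := by
  have hp0 : 0 < p := by linarith
  have hσu := densM_univ γ m hm σ hσ
  have hρu := densM_univ γ m hm ρ hρ
  have aσ := densM_add γ σ hσ.1 hσ.2.1
  have aρ := densM_add γ ρ hρ.1 hρ.2.1
  set μ' := densM γ σ with hμ'
  set ν' := densM γ (fun x => 1 - σ x) with hν'
  set μ := densM γ ρ with hμ
  set ν := densM γ (fun x => 1 - ρ x) with hν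
  have : IsFiniteMeasure μ' := ⟨by rw [hσu]; exact ENNReal.ofReal_lt_top⟩
  have : IsFiniteMeasure μ := ⟨by rw [hρu]; exact ENNReal.ofReal_lt_top⟩
  have hν'γ : ν' ≤ γ := by
    conv_rhs => rw [← aσ]
    exact Measure.le_add_left le_rfl
  have hνγ : ν ≤ γ := by
    conv_rhs => rw [← aρ]
    exact Measure.le_add_left le_rfl
  have : SigmaFinite ν' := Measure.sigmaFinite_of_le γ hν'γ
  have hbig : ∀ k, 2 * μ' univ ≤ ν' (Q ⁻¹' {k}) := fun k => by
    have h := hQm k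
    rw [← aσ, Measure.add_apply] at h
    have h3 : ENNReal.ofReal (3 * m) = μ' univ + 2 * μ' univ := by
      rw [ENNReal.ofReal_mul (by norm_num), hσu, ENNReal.ofReal_ofNat]; ring
    rw [h3] at h
    exact ENNReal.le_of_add_le_add_left (measure_ne_top μ' univ)
      (h.trans (add_le_add_left (measure_mono (subset_univ _)) _))
  have hcomp := complete p hp μ' ν' Q hQ D hQd (fun k => ne_top_of_le_ne_top (hQf k) (hν'γ _)) hbig
  constructor
  · obtain ⟨π, h1, h2, h3⟩ := hcomp 0 (by simp only [Measure.map_zero]; exact Measure.zero_le _) (by simp only [Measure.map_zero]; exact Measure.zero_le _)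
    refine (plan_le p γ m hm σ hσ π ⟨h1, h2⟩).trans (h3.trans ?_)
    simp [tCost, hσu]
  set η := (∑' i, (μ (q ⁻¹' {i}) - μ' (q ⁻¹' {i}))) + ∑' i, (μ' (q ⁻¹' {i}) - μ (q ⁻¹' {i}))
    with hη
  have hdef : ∀ i, ν (q ⁻¹' {i}) - ν' (q ⁻¹' {i}) ≤ μ' (q ⁻¹' {i}) - μ (q ⁻¹' {i}) := fun i => by
    rw [tsub_le_iff_right]
    refine ENNReal.le_of_add_le_add_left (measure_ne_top μ (q ⁻¹' {i})) ?_
    rw [← Measure.add_apply, aρ]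
    conv_lhs => rw [← aσ]
    rw [Measure.add_apply, ← add_assoc]
    gcongr
    exact le_add_tsub
  have key : ∀ π, AP γ ρ π → WEnergyPow p γ σ ^ (1 / p) ≤ tCost p π ^ (1 / p) +
      (ENNReal.ofReal (2 * d) * ENNReal.ofReal m ^ (1 / p) +
        (ENNReal.ofReal (D ^ p) * η) ^ (1 / p)) := by
    rintro π ⟨h1, h2⟩
    have hU : π univ = ENNReal.ofReal m := by
      rw [← hρu, hμ, ← h1, Measure.map_apply measurable_fst MeasurableSet.univ, preimage_univ]
    obtain ⟨π₁, b1, b2, b3, b4⟩ := transfer p hp μ ν μ' ν' q hq d hd hqd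
      (fun k => measure_ne_top _ _) (fun k => ne_top_of_le_ne_top (hqf k) (hνγ _))
      (fun k => measure_ne_top _ _) (fun k => ne_top_of_le_ne_top (hqf k) (hν'γ _)) π h1 h2
    obtain ⟨π₂, c1, c2, c3⟩ := hcomp π₁ b1 b2
    have hdefi : μ' univ - π₁ univ ≤ η := by
      rw [hσu, ← hU, tsub_le_iff_left]
      refine b3.trans ?_
      rw [hη]
      refine add_le_add_right (add_le_add_right ?_ _) _
      exact ENNReal.tsum_le_tsum hdef
    have hmink := ENNReal.lintegral_Lp_add_le (μ := π)
      (f := fun z => ENNReal.ofReal (dist z.1 z.2)) (g := fun _ => ENNReal.ofReal (2 * d))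
      (by fun_prop) (by fun_prop) hp.le
    calc WEnergyPow p γ σ ^ (1 / p)
        ≤ (tCost p π₁ + ENNReal.ofReal (D ^ p) * η) ^ (1 / p) := by
          refine ENNReal.rpow_le_rpow ?_ (by positivity)
          refine (plan_le p γ m hm σ hσ π₂ ⟨c1, c2⟩).trans (c3.trans ?_)
          gcongr
      _ ≤ tCost p π₁ ^ (1 / p) + (ENNReal.ofReal (D ^ p) * η) ^ (1 / p) :=
          ENNReal.rpow_add_le_add_rpow _ _ (by positivity)
            (by rw [div_le_one hp0]; exact hp.le)
      _ ≤ (∫⁻ z, (ENNReal.ofReal (dist z.1 z.2) + ENNReal.ofReal (2 * d)) ^ p ∂π) ^ (1 / p) +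
          (ENNReal.ofReal (D ^ p) * η) ^ (1 / p) := by gcongr
      _ ≤ (tCost p π ^ (1 / p) + ENNReal.ofReal (2 * d) * ENNReal.ofReal m ^ (1 / p)) +
          (ENNReal.ofReal (D ^ p) * η) ^ (1 / p) := by
          gcongr
          refine hmink.trans (le_of_eq ?_)
          congr 1
          · simp only [tCost]
            congr 2; ext z
            rw [ENNReal.ofReal_rpow_of_nonneg dist_nonneg hp0.le]
          · rw [lintegral_const, hU, ENNReal.mul_rpow_of_nonneg _ _ (by positivity),
              ← ENNReal.rpow_mul, mul_one_div_cancel hp0.ne', ENNReal.rpow_one]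
      _ = _ := add_assoc _ _ _
  simp only [WEnergy]
  rw [← tsub_le_iff_right, rp_iff hp0]
  refine le_iInf₂ fun ρ' hadm => le_iInf₂ fun π hπ => ?_
  rw [← rp_iff hp0, tsub_le_iff_right]
  exact key π (adm_AP γ ρ ρ' hadm π hπ)

end energy

section conv

lemma eta_tendsto {ι : Type*} [Countable ι] (r : ι → ℝ≥0∞) (rn : ℕ → ι → ℝ≥0∞) (M : ℝ≥0∞)
    (hM : M ≠ ⊤) (hr : ∑' i, r i = M) (hrn : ∀ n, ∑' i, rn n i = M)
    (h : ∀ i, Tendsto (fun n => rn n i) atTop (nhds (r i))) :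
    Tendsto (fun n => (∑' i, (r i - rn n i)) + ∑' i, (rn n i - r i)) atTop (nhds 0) := by
  have e : ∀ n, ∑' i, (rn n i - r i) = ∑' i, (r i - rn n i) := fun n => by
    have h1 : ∑' i, (rn n i - r i) + M = ∑' i, (r i - rn n i) + M := by
      conv_lhs => rw [← hr]
      conv_rhs => rw [← hrn n]
      rw [← ENNReal.tsum_add, ← ENNReal.tsum_add]
      congr 1; ext i
      rw [tsub_add_eq_max, tsub_add_eq_max, max_comm]
    exact (ENNReal.add_left_inj hM).1 h1
  simp_rw [e]
  have hne : ∀ i, r i ≠ ⊤ := fun i => ne_top_of_le_ne_top hM (hr ▸ ENNReal.le_tsum i)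
  have key : Tendsto (fun n => ∑' i, (r i - rn n i)) atTop (nhds 0) := by
    let : MeasurableSpace ι := ⊤
    have := tendsto_lintegral_of_dominated_convergence (μ := (Measure.count : Measure ι))
      (F := fun n i => r i - rn n i) (f := fun _ => 0) r (fun n => measurable_from_top)
      (fun n => ae_of_all _ fun i => tsub_le_self)
      (by rw [lintegral_count, hr]; exact hM)
      (ae_of_all _ fun i => by
        have := ENNReal.Tendsto.sub (tendsto_const_nhds (x := r i)) (h i) (Or.inl (hne i))
        simpa using this)
    simpa [lintegral_count] using this
  simpa using key.add key

lemma densM_tendsto {N : ℕ} (m : ℝ) (hm : 0 < m)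
    (ρ : Euc N → ℝ) (hρ : memA volume m ρ)
    (ρn : ℕ → Euc N → ℝ) (hρn : ∀ n, memA volume m (ρn n))
    (hconv : ∀ φ : Euc N → ℝ, Continuous φ → HasCompactSupport φ →
      Filter.Tendsto (fun n => ∫ x, φ x * ρn n x) Filter.atTop (nhds (∫ x, φ x * ρ x)))
    (A : Set (Euc N)) (hA : MeasurableSet A) (hAf : volume A ≠ ⊤) :
    Tendsto (fun n => densM volume (ρn n) A) atTop (nhds (densM volume ρ A)) := by
  have hint : ∀ σ : Euc N → ℝ, memA volume m σ → ∀ φ : Euc N → ℝ, Integrable φ →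
      Integrable (fun x => φ x * σ x) := fun σ hσ φ hφ => by
    refine hφ.mul_bdd (c := 1) hσ.1.aestronglyMeasurable ?_
    filter_upwards [hσ.2.1] with x hx
    rw [Real.norm_eq_abs, abs_le]; constructor <;> linarith
  have hind : Integrable (A.indicator (fun _ => (1:ℝ))) (volume : Measure (Euc N)) :=
    (integrable_indicator_iff hA).2 (integrableOn_const hAf)
  have hd : ∀ σ : Euc N → ℝ, memA volume m σ → densM volume σ A =
      ENNReal.ofReal (∫ x, A.indicator (fun _ => (1:ℝ)) x * σ x) := fun σ hσ => by
    rw [densM, withDensity_apply _ hA, ofReal_integral_eq_lintegral_ofReal (hint σ hσ _ hind)]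
    · rw [← lintegral_indicator hA]
      congr 1; ext x
      by_cases hx : x ∈ A <;> simp [hx]
    · filter_upwards [hσ.2.1] with x hx
      exact mul_nonneg (indicator_nonneg (fun _ _ => zero_le_one) _) hx.1
  rw [hd ρ hρ]
  simp_rw [fun n => hd _ (hρn n)]
  refine ENNReal.tendsto_ofReal ?_
  rw [Metric.tendsto_atTop]
  intro ε hε
  obtain ⟨φ, hφs, hφ, hφc, hφi⟩ := hind.exists_hasCompactSupport_integral_sub_le
    (show 0 < ε / 4 by linarith)
  have happ : ∀ σ : Euc N → ℝ, memA volume m σ →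
      |(∫ x, A.indicator (fun _ => (1:ℝ)) x * σ x) - ∫ x, φ x * σ x| ≤ ε / 4 := fun σ hσ => by
    rw [← integral_sub (hint σ hσ _ hind) (hint σ hσ _ hφi)]
    refine (abs_integral_le_integral_abs).trans (le_trans ?_ hφ)
    refine integral_mono_ae ((hint σ hσ _ hind).sub (hint σ hσ _ hφi)).abs (hind.sub hφi).norm ?_
    filter_upwards [hσ.2.1] with x hx
    rw [← sub_mul, abs_mul, Real.norm_eq_abs]
    exact mul_le_of_le_one_right (abs_nonneg _) (by rw [abs_le]; constructor <;> linarith)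
  obtain ⟨n₀, hn₀⟩ := Metric.tendsto_atTop.1 (hconv φ hφc hφs) (ε / 4) (by linarith)
  refine ⟨n₀, fun n hn => ?_⟩
  have a1 := abs_le.1 (happ _ (hρn n))
  have a2 := abs_le.1 (happ _ hρ)
  have a3 := hn₀ n hn
  rw [Real.dist_eq, abs_lt] at a3 ⊢
  constructor <;> linarith [a1.1, a1.2, a2.1, a2.2, a3.1, a3.2]

def grid (N : ℕ) (d : ℝ) (x : Euc N) : Fin N → ℤ := fun k => ⌊x k / d⌋

lemma grid_meas (N : ℕ) (d : ℝ) (k : Fin N → ℤ) : MeasurableSet (grid N d ⁻¹' {k}) := by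
  have : Measurable (grid N d) := by
    refine measurable_pi_iff.2 fun i => ?_
    exact Int.measurable_floor.comp (by fun_prop)
  exact this (measurableSet_singleton k)

lemma grid_dist (N : ℕ) (d : ℝ) (hd : 0 < d) (x y : Euc N) (h : grid N d x = grid N d y) :
    dist x y ≤ (N + 1) * d := by
  rw [EuclideanSpace.dist_eq]
  refine Real.sqrt_le_iff.2 ⟨by positivity, ?_⟩
  have hk : ∀ k, dist (x k) (y k) ^ 2 ≤ d ^ 2 := fun k => by
    have h1 : ⌊x k / d⌋ = ⌊y k / d⌋ := congrFun h k
    have h2 := Int.abs_sub_lt_one_of_floor_eq_floor h1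
    rw [← sub_div, abs_div, abs_of_pos hd, div_lt_one hd] at h2
    rw [Real.dist_eq]
    gcongr
  calc ∑ k, dist (x k) (y k) ^ 2 ≤ ∑ _k : Fin N, d ^ 2 := Finset.sum_le_sum fun k _ => hk k
    _ = N * d ^ 2 := by simp
    _ ≤ _ := by
      rw [mul_pow]
      have : (0:ℝ) ≤ N := Nat.cast_nonneg N
      gcongr
      nlinarith

lemma grid_fin (N : ℕ) (d : ℝ) (hd : 0 < d) (k : Fin N → ℤ) :
    (volume : Measure (Euc N)) (grid N d ⁻¹' {k}) ≠ ⊤ := by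
  refine (Bornology.IsBounded.measure_lt_top ?_).ne
  refine Metric.isBounded_iff.2 ⟨(N + 1) * d, fun x hx y hy => grid_dist N d hd x y ?_⟩
  simp only [mem_preimage, mem_singleton_iff] at hx hy
  rw [hx, hy]

lemma grid_big (N : ℕ) (hN : N ≠ 0) (m : ℝ) (hm : 0 < m) : ∃ d : ℝ, 0 < d ∧
    ∀ k : Fin N → ℤ, ENNReal.ofReal m ≤ (volume : Measure (Euc N)) (grid N d ⁻¹' {k}) := by
  set V := (volume : Measure (Euc N)) (ball 0 1) with hV
  have hV0 : 0 < V := measure_ball_pos _ _ one_pos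
  have hVt : V ≠ ⊤ := measure_ball_lt_top.ne
  have hVr : 0 < V.toReal := ENNReal.toReal_pos hV0.ne' hVt
  set r : ℝ := max 1 (m / V.toReal) with hr
  have hr1 : 1 ≤ r := le_max_left _ _
  have hr0 : 0 < r := by linarith
  refine ⟨2 * r, by linarith, fun k => ?_⟩
  let c : Euc N := WithLp.toLp 2 (fun i => (2 * r) * ((k i : ℝ) + 1 / 2))
  have hsub : ball c r ⊆ grid N (2 * r) ⁻¹' {k} := by
    intro x hx
    rw [mem_ball] at hx
    simp only [mem_preimage, mem_singleton_iff]
    ext i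
    have h1 : dist (x i) (c i) < r := by
      refine lt_of_le_of_lt ?_ hx
      rw [dist_eq_norm, dist_eq_norm]
      exact PiLp.norm_apply_le (x - c) i
    have h2 : c i = (2 * r) * ((k i : ℝ) + 1 / 2) := rfl
    rw [h2, Real.dist_eq, abs_lt] at h1
    simp only [grid]
    rw [Int.floor_eq_iff, le_div_iff₀ (by linarith), div_lt_iff₀ (by linarith)]
    constructor <;> nlinarith [h1.1, h1.2]
  refine le_trans ?_ (measure_mono hsub)
  rw [Measure.addHaar_ball_of_pos _ _ hr0, finrank_euclideanSpace_fin, ← hV,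
    ← ENNReal.ofReal_toReal hVt, ← ENNReal.ofReal_mul (by positivity)]
  apply ENNReal.ofReal_le_ofReal
  have h3 : r ≤ r ^ N := le_self_pow₀ hr1 hN
  have h4 : m / V.toReal ≤ r := le_max_right _ _
  rw [div_le_iff₀ hVr] at h4
  nlinarith

end conv

/-- Continuity of `𝒲_p` with respect to weak-* convergence without loss of mass:
if `ρ_n ∈ A_m` converge weakly-* to `ρ ∈ A_m`, then `𝒲_p(ρ_n) → 𝒲_p(ρ)`. -/
theorem weak_star_continuity {N : ℕ} (p : ℝ) (hp : 1 < p) (m : ℝ) (hm : 0 < m)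
    (ρ : Euc N → ℝ) (hρ : memA volume m ρ)
    (ρn : ℕ → Euc N → ℝ) (hρn : ∀ n, memA volume m (ρn n))
    (hconv : ∀ φ : Euc N → ℝ, Continuous φ → HasCompactSupport φ →
      Filter.Tendsto (fun n => ∫ x, φ x * ρn n x) Filter.atTop (nhds (∫ x, φ x * ρ x))) :
    Filter.Tendsto (fun n => WEnergy p volume (ρn n)) Filter.atTop
      (nhds (WEnergy p volume ρ)) := by
  have hp0 : 0 < p := by linarith
  rcases Nat.eq_zero_or_pos N with hN | hN
  · subst hN
    have e : ∀ n, ρn n = ρ := fun n => by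
      have h1 := (hρn n).2.2
      have h2 := hρ.2.2
      rw [integral_unique] at h1 h2
      have hv : (volume : Measure (Euc 0)).real univ ≠ 0 := fun h => by
        rw [h, zero_smul] at h2; linarith
      have h3 := h1.trans h2.symm
      simp only [smul_eq_mul] at h3
      have h4 := mul_left_cancel₀ hv h3
      ext x
      convert h4 <;> exact Subsingleton.elim _ _
    simp_rw [e]
    exact tendsto_const_nhds
  obtain ⟨L, hL, hLm⟩ := grid_big N hN.ne' (3 * m) (by linarith)
  set D : ℝ := (N + 1) * L with hD
  have main : ∀ (σ τ : Euc N → ℝ), memA volume m σ → memA volume m τ → ∀ d : ℝ, 0 < d → _ :=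
    fun σ τ hσ hτ d hd => energy_le p hp (volume : Measure (Euc N)) m hm σ τ hσ hτ
      (grid N d) (grid_meas N d) ((N + 1) * d) (by positivity) (grid_dist N d hd) (grid_fin N d hd)
      (grid N L) (grid_meas N L) D (grid_dist N L hL) (grid_fin N L hL) hLm
  have hfin : WEnergy p volume ρ ≠ ⊤ := by
    refine ENNReal.rpow_ne_top_of_nonneg (by positivity) ?_
    exact ne_top_of_le_ne_top (ENNReal.mul_ne_top ENNReal.ofReal_ne_top ENNReal.ofReal_ne_top)
      (main ρ ρ hρ hρ 1 one_pos).1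
  rw [ENNReal.tendsto_nhds hfin]
  intro ε hε
  have hε2 : 0 < ε / 2 := ENNReal.half_pos hε.ne'
  obtain ⟨d, hd, hdε⟩ : ∃ d : ℝ, 0 < d ∧
      ENNReal.ofReal (2 * ((N + 1) * d)) * ENNReal.ofReal m ^ (1 / p) ≤ ε / 2 := by
    have hmt : ENNReal.ofReal m ^ (1 / p) ≠ ⊤ :=
      ENNReal.rpow_ne_top_of_nonneg (by positivity) ENNReal.ofReal_ne_top
    have ht : Tendsto (fun d : ℝ => ENNReal.ofReal (2 * ((N + 1) * d)) * ENNReal.ofReal m ^ (1 / p))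
        (nhdsWithin 0 (Ioi 0)) (nhds 0) := by
      have h1 : Tendsto (fun d : ℝ => 2 * (((N:ℝ) + 1) * d)) (nhdsWithin 0 (Ioi 0)) (nhds 0) := by
        have : Continuous (fun d : ℝ => 2 * (((N:ℝ) + 1) * d)) := by fun_prop
        have h := this.tendsto 0
        simp only [mul_zero] at h
        exact h.mono_left nhdsWithin_le_nhds
      have h2 := ENNReal.Tendsto.mul_const (ENNReal.tendsto_ofReal h1)
        (b := ENNReal.ofReal m ^ (1 / p)) (Or.inr hmt)
      simpa using h2
    obtain ⟨d, h1, h2⟩ := ((ht.eventually_le_const hε2).and self_mem_nhdsWithin).exists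
    exact ⟨d, h2, h1⟩
  have hη := eta_tendsto (fun i => densM volume ρ (grid N d ⁻¹' {i}))
    (fun n i => densM volume (ρn n) (grid N d ⁻¹' {i})) (ENNReal.ofReal m) ENNReal.ofReal_ne_top
    (by rw [part_tsum _ _ (grid_meas N d), densM_univ _ m hm ρ hρ])
    (fun n => by rw [part_tsum _ _ (grid_meas N d), densM_univ _ m hm _ (hρn n)])
    (fun i => densM_tendsto m hm ρ hρ ρn hρn hconv _ (grid_meas N d i) (grid_fin N d hd i))
  have hη2 := (ENNReal.Tendsto.const_mul hη
    (a := ENNReal.ofReal (D ^ p)) (Or.inr ENNReal.ofReal_ne_top)).ennrpow_const (1 / p)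
  rw [mul_zero, ENNReal.zero_rpow_of_pos (by positivity)] at hη2
  filter_upwards [hη2.eventually_le_const hε2] with n hn
  have b1 := (main ρ (ρn n) hρ (hρn n) d hd).2
  have b2 := (main (ρn n) ρ (hρn n) hρ d hd).2
  constructor
  · rw [tsub_le_iff_right]
    refine b2.trans (add_le_add_right ?_ _)
    rw [← ENNReal.add_halves ε, add_comm (tsum _)]
    exact add_le_add hdε hn
  · refine b1.trans (add_le_add_right ?_ _)
    rw [← ENNReal.add_halves ε]
    exact add_le_add hdε hn
end
end

section
/- Let p>1 and ρ ∈ A. Then there exists a sequence of measurable sets E_n ⊂ ℝ^N with |E_n| = 1 such that the measures χ_{E_n} ℒ^N converge weak* to ρ ℒ^N and 𝒲_p(χ_{E_n}) → 𝒲_p(ρ); moreover, for every sequence of sets E_n with |E_n|=1 and χ_{E_n} ℒ^N ⇀* ρ ℒ^N one has liminf_n 𝒲_p(χ_{E_n}) ≥ 𝒲_p(ρ). In other words, ρ ↦ 𝒲_p(ρ) on A is the weak*-lower semicontinuous envelope of the set functional E ↦ 𝒲_p(χ_E). -/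
open MeasureTheory ENNReal Set Metric Filter

noncomputable section

lemma exists_sub_vol {N : ℕ} (hN : 1 ≤ N) (S : Set (Euc N)) (hS : MeasurableSet S)
    (hSf : volume S ≠ ∞) (m : ℝ≥0∞) (hm : m ≤ volume S) :
    ∃ T, T ⊆ S ∧ MeasurableSet T ∧ volume T = m := by
  rcases hm.eq_or_lt with h | h
  · exact ⟨S, subset_rfl, hS, h.symm⟩
  have : Nonempty (Fin N) := ⟨⟨0, hN⟩⟩
  have : Nontrivial (Euc N) := inferInstance
  have : IsFiniteMeasure (volume.restrict S) := ⟨by simpa using hSf.lt_top⟩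
  let ν : Measure ℝ := (volume.restrict S).map (fun x : Euc N => ‖x‖)
  have : IsFiniteMeasure ν := by infer_instance
  have : NullSingletonClass ν := ⟨fun r => by
    rw [Measure.map_apply measurable_norm (measurableSet_singleton r)]
    have : (fun x : Euc N => ‖x‖) ⁻¹' {r} = sphere 0 r := by ext; simp
    rw [this]
    exact le_antisymm ((Measure.restrict_apply_le _ _).trans (Measure.addHaar_sphere volume _ _).le) bot_le⟩
  have hint : ∀ a b : ℝ, IntervalIntegrable (fun _ => (1:ℝ)) ν a b := fun a b => by simp
  have hc := intervalIntegral.continuous_primitive hint 0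
  have hlim := intervalIntegral_tendsto_integral_Ioi (μ := ν) (f := fun _ => (1:ℝ)) 0
    (by simp) tendsto_id
  have hval : ∫ x in Ioi (0:ℝ), (1:ℝ) ∂ν = (volume S).toReal := by
    have : ν (Ioi 0) = volume S := by
      have h1 : ν (Ioi 0) = ν (Ici 0) := measure_congr Ioi_ae_eq_Ici
      rw [h1, Measure.map_apply measurable_norm measurableSet_Ici]
      have : (fun x : Euc N => ‖x‖) ⁻¹' (Ici 0) = univ := by ext; simp
      rw [this]; simp
    simp [measureReal_def, this]
  rw [hval] at hlim
  have hlt : m.toReal < (volume S).toReal := (ENNReal.toReal_lt_toReal h.ne_top hSf).2 h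
  obtain ⟨t, ht, ht0⟩ := ((hlim.eventually (lt_mem_nhds hlt)).and (eventually_ge_atTop 0)).exists
  have := intermediate_value_Icc ht0 hc.continuousOn
  obtain ⟨s, hs, hs'⟩ := this (show m.toReal ∈ _ from ⟨by simp, ht.le⟩)
  refine ⟨S ∩ {x | ‖x‖ ∈ Ioc 0 s}, inter_subset_left, hS.inter (measurable_norm measurableSet_Ioc), ?_⟩
  have e : ν (Ioc 0 s) = volume (S ∩ {x : Euc N | ‖x‖ ∈ Ioc 0 s}) := by
    rw [Measure.map_apply measurable_norm measurableSet_Ioc,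
      Measure.restrict_apply (measurable_norm measurableSet_Ioc), inter_comm]; rfl
  rw [← e]
  dsimp only at hs'
  rw [intervalIntegral.integral_of_le hs.1] at hs'
  simp only [integral_const, smul_eq_mul, mul_one, measureReal_def, Measure.restrict_apply_univ] at hs'
  exact (ENNReal.toReal_eq_toReal_iff' (measure_ne_top _ _) h.ne_top).1 hs'

lemma exists_partition {N : ℕ} (δ : ℝ) (hδ : 0 < δ) :
    ∃ q : Euc N → ℕ, Measurable q ∧ (∀ x y, q x = q y → dist x y ≤ δ) ∧
      ∀ i, volume (q ⁻¹' {i}) ≠ ∞ := by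
  classical
  have hex : ∀ x : Euc N, ∃ n, dist x (TopologicalSpace.denseSeq (Euc N) n) < δ / 2 := fun x =>
    (TopologicalSpace.denseRange_denseSeq (Euc N)).exists_dist_lt x (by positivity)
  have hsp := fun x => Nat.find_spec (hex x)
  refine ⟨fun x => Nat.find (hex x), ?_, ?_, ?_⟩
  · exact measurable_find hex fun k => measurableSet_lt (by fun_prop) (by fun_prop)
  · intro x y h
    have h1 := hsp x
    have h2 := hsp y
    simp only at h
    rw [← h] at h2
    have := dist_triangle_right x y (TopologicalSpace.denseSeq (Euc N) (Nat.find (hex x)))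
    linarith
  · intro i
    have : (fun x => Nat.find (hex x)) ⁻¹' {i} ⊆
        ball (TopologicalSpace.denseSeq (Euc N) i) (δ / 2) := by
      rintro x rfl
      exact hsp x
    exact ((measure_mono this).trans_lt measure_ball_lt_top).ne

lemma discretize {N : ℕ} (hN : 1 ≤ N) (q : Euc N → ℕ) (hq : Measurable q)
    (hf : ∀ i, volume (q ⁻¹' {i}) ≠ ∞) (μ ν : Measure (Euc N)) (h : μ + ν ≤ volume) :
    ∃ A B : Set (Euc N), MeasurableSet A ∧ MeasurableSet B ∧ Disjoint A B ∧
      (volume.restrict A).map q = μ.map q ∧ (volume.restrict B).map q = ν.map q := by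
  have hQ : ∀ i, MeasurableSet (q ⁻¹' {i}) := fun i => hq (measurableSet_singleton i)
  have hle : ∀ s, μ s + ν s ≤ volume s := fun s => by simpa using h s
  have h1 : ∀ i, ∃ T, T ⊆ q ⁻¹' {i} ∧ MeasurableSet T ∧ volume T = μ (q ⁻¹' {i}) := fun i =>
    exists_sub_vol hN _ (hQ i) (hf i) _ (le_self_add.trans (hle _))
  choose E hE hEm hEv using h1
  have h2 : ∀ i, ∃ T, T ⊆ q ⁻¹' {i} \ E i ∧ MeasurableSet T ∧ volume T = ν (q ⁻¹' {i}) := fun i => by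
    refine exists_sub_vol hN _ ((hQ i).diff (hEm i)) (measure_ne_top_of_subset sdiff_subset (hf i)) _ ?_
    rw [measure_sdiff (hE i) (hEm i).nullMeasurableSet (measure_ne_top_of_subset (hE i) (hf i)), hEv]
    refine ENNReal.le_sub_of_add_le_left ?_ (hle _)
    rw [← hEv]; exact measure_ne_top_of_subset (hE i) (hf i)
  choose F hF hFm hFv using h2
  have key : ∀ (G : ℕ → Set (Euc N)), (∀ i, G i ⊆ q ⁻¹' {i}) → ∀ i, q ⁻¹' {i} ∩ (⋃ j, G j) = G i := by
    intro G hG i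
    ext x
    simp only [mem_inter_iff, mem_preimage, mem_singleton_iff, mem_iUnion]
    constructor
    · rintro ⟨h, j, hj⟩
      have : q x = j := hG j hj
      subst this; subst h; exact hj
    · intro h; exact ⟨hG i h, i, h⟩
  have hF' : ∀ i, F i ⊆ q ⁻¹' {i} := fun i => (hF i).trans sdiff_subset
  refine ⟨⋃ i, E i, ⋃ i, F i, .iUnion hEm, .iUnion hFm, ?_, ?_, ?_⟩
  · rw [disjoint_iUnion_left]; intro i
    rw [disjoint_iUnion_right]; intro j
    rw [Set.disjoint_left]
    intro x hx hy
    have e1 : q x = i := hE i hx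
    have e2 : q x = j := hF' j hy
    have : i = j := e1.symm.trans e2
    subst this
    exact (hF i hy).2 hx
  · refine Measure.ext_of_singleton fun i => ?_
    rw [Measure.map_apply hq (measurableSet_singleton i), Measure.map_apply hq (measurableSet_singleton i),
      Measure.restrict_apply (hQ i), key E hE, hEv]
  · refine Measure.ext_of_singleton fun i => ?_
    rw [Measure.map_apply hq (measurableSet_singleton i), Measure.map_apply hq (measurableSet_singleton i),
      Measure.restrict_apply (hQ i), key F hF', hFv]

lemma plan_transfer {N : ℕ} (p : ℝ) (hp : 1 < p) (δ : ℝ) (q : Euc N → ℕ) (hq : Measurable q)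
    (hd : ∀ x y, q x = q y → dist x y ≤ δ) (hδ : 0 < δ)
    (μ ν μ' ν' : Measure (Euc N)) [IsFiniteMeasure μ'] [IsFiniteMeasure ν']
    (hμ : μ'.map q = μ.map q) (hν : ν'.map q = ν.map q)
    (π : Measure (Euc N × Euc N)) (hπ : IsCoupling π μ ν) :
    WpPow p μ' ν' ≤ ∫⁻ z, ENNReal.ofReal ((dist z.1 z.2 + 2 * δ) ^ p) ∂π := by
  have hQ : ∀ i, MeasurableSet (q ⁻¹' {i}) := fun i => hq (measurableSet_singleton i)
  obtain ⟨h1, h2⟩ := hπ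
  let a : ℕ → ℝ≥0∞ := fun i => μ' (q ⁻¹' {i})
  let b : ℕ → ℝ≥0∞ := fun i => ν' (q ⁻¹' {i})
  let R : ℕ × ℕ → Set (Euc N × Euc N) := fun ij => (q ⁻¹' {ij.1}) ×ˢ (q ⁻¹' {ij.2})
  have hR : ∀ ij, MeasurableSet (R ij) := fun ij => (hQ _).prod (hQ _)
  have hRd : Pairwise (Function.onFun Disjoint R) := by
    intro i j hij
    rw [Function.onFun, Set.disjoint_left]
    rintro ⟨x, y⟩ ⟨h, h'⟩ ⟨g, g'⟩
    exact hij (Prod.ext (h.symm.trans g) (h'.symm.trans g'))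
  have hRu : ⋃ ij, R ij = univ := by
    refine eq_univ_of_forall fun z => mem_iUnion.2 ⟨(q z.1, q z.2), rfl, rfl⟩
  have ha : ∀ i, a i ≠ ∞ := fun i => measure_ne_top _ _
  have hb : ∀ i, b i ≠ ∞ := fun i => measure_ne_top _ _
  have hma : ∀ i, ∑' j, π (R (i, j)) = a i := by
    intro i
    have hdj : Pairwise (Function.onFun Disjoint fun j => R (i, j)) :=
      fun j k hjk => hRd (fun h => hjk (Prod.ext_iff.1 h).2)
    rw [← measure_iUnion hdj (fun j => hR _)]
    have e : ⋃ j, R (i, j) = Prod.fst ⁻¹' (q ⁻¹' {i}) := by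
      ext z; simp [R]
    rw [e, ← Measure.map_apply measurable_fst (hQ i), h1, ← Measure.map_apply hq (measurableSet_singleton i),
      ← hμ, Measure.map_apply hq (measurableSet_singleton i)]
  have hmb : ∀ j, ∑' i, π (R (i, j)) = b j := by
    intro j
    have hdj : Pairwise (Function.onFun Disjoint fun i => R (i, j)) :=
      fun i k hjk => hRd (fun h => hjk (Prod.ext_iff.1 h).1)
    rw [← measure_iUnion hdj (fun j => hR _)]
    have e : ⋃ i, R (i, j) = Prod.snd ⁻¹' (q ⁻¹' {j}) := by
      ext z; simp [R]
    rw [e, ← Measure.map_apply measurable_snd (hQ j), h2, ← Measure.map_apply hq (measurableSet_singleton j),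
      ← hν, Measure.map_apply hq (measurableSet_singleton j)]
  have hza : ∀ i j, a i = 0 → π (R (i, j)) = 0 := fun i j h => by
    have := ENNReal.le_tsum (f := fun j => π (R (i, j))) j
    rw [hma, h] at this; simpa using this
  have hzb : ∀ i j, b j = 0 → π (R (i, j)) = 0 := fun i j h => by
    have := ENNReal.le_tsum (f := fun i => π (R (i, j))) i
    rw [hmb, h] at this; simpa using this
  let c : ℕ × ℕ → ℝ≥0∞ := fun ij => π (R ij) * (a ij.1)⁻¹ * (b ij.2)⁻¹
  have hcb : ∀ i j, c (i, j) * b j = π (R (i, j)) * (a i)⁻¹ := fun i j => by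
    by_cases h : b j = 0
    · simp [h, hzb i j h]
    · simp only [c]; rw [mul_assoc, ENNReal.inv_mul_cancel h (hb j), mul_one]
  have hca : ∀ i j, c (i, j) * a i = π (R (i, j)) * (b j)⁻¹ := fun i j => by
    by_cases h : a i = 0
    · simp [h, hza i j h]
    · simp only [c]; rw [mul_right_comm, mul_assoc _ (a i)⁻¹, ENNReal.inv_mul_cancel h (ha i), mul_one]
  let P : Measure (Euc N × Euc N) := Measure.sum fun ij : ℕ × ℕ =>
    c ij • (μ'.restrict (q ⁻¹' {ij.1})).prod (ν'.restrict (q ⁻¹' {ij.2}))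
  have hdec : ∀ (m : Measure (Euc N)) (S : Set (Euc N)), MeasurableSet S →
      ∑' i, m.restrict (q ⁻¹' {i}) S = m S := by
    intro m S hS
    have : S = ⋃ i, S ∩ q ⁻¹' {i} := by ext; simp
    conv_rhs => rw [this]
    rw [measure_iUnion _ (fun i => hS.inter (hQ i))]
    · simp_rw [Measure.restrict_apply hS]
    · intro i j hij
      rw [Function.onFun, Set.disjoint_left]
      rintro x ⟨_, h⟩ ⟨_, g⟩
      exact hij (h.symm.trans g)
  have hP : IsCoupling P μ' ν' := by
    constructor
    · ext S hS
      rw [Measure.map_apply measurable_fst hS, Measure.sum_apply _ (measurable_fst hS), ENNReal.tsum_prod',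
        ← hdec μ' S hS]
      congr 1; ext i
      have : ∀ j, (c (i, j) • (μ'.restrict (q ⁻¹' {i})).prod (ν'.restrict (q ⁻¹' {j}))) (Prod.fst ⁻¹' S)
          = π (R (i, j)) * ((a i)⁻¹ * μ'.restrict (q ⁻¹' {i}) S) := by
        intro j
        rw [Measure.smul_apply, ← Measure.map_apply measurable_fst hS, Measure.map_fst_prod, Measure.smul_apply,
          smul_eq_mul, smul_eq_mul, Measure.restrict_apply_univ, ← mul_assoc]
        change c (i, j) * b j * _ = _
        rw [hcb, mul_assoc]
      simp only [this]
      rw [ENNReal.tsum_mul_right, hma]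
      by_cases h : a i = 0
      · have : μ'.restrict (q ⁻¹' {i}) = 0 := Measure.restrict_eq_zero.2 h
        simp [this]
      · rw [← mul_assoc, ENNReal.mul_inv_cancel h (ha i), one_mul]
    · ext S hS
      rw [Measure.map_apply measurable_snd hS, Measure.sum_apply _ (measurable_snd hS), ENNReal.tsum_prod',
        ENNReal.tsum_comm, ← hdec ν' S hS]
      congr 1; ext j
      have : ∀ i, (c (i, j) • (μ'.restrict (q ⁻¹' {i})).prod (ν'.restrict (q ⁻¹' {j}))) (Prod.snd ⁻¹' S)
          = π (R (i, j)) * ((b j)⁻¹ * ν'.restrict (q ⁻¹' {j}) S) := by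
        intro i
        rw [Measure.smul_apply, ← Measure.map_apply measurable_snd hS, Measure.map_snd_prod, Measure.smul_apply,
          smul_eq_mul, smul_eq_mul, Measure.restrict_apply_univ, ← mul_assoc]
        change c (i, j) * a i * _ = _
        rw [hca, mul_assoc]
      simp only [this]
      rw [ENNReal.tsum_mul_right, hmb]
      by_cases h : b j = 0
      · have : ν'.restrict (q ⁻¹' {j}) = 0 := Measure.restrict_eq_zero.2 h
        simp [this]
      · rw [← mul_assoc, ENNReal.mul_inv_cancel h (hb j), one_mul]
  refine (iInf₂_le P hP).trans ?_
  unfold tCost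
  rw [lintegral_sum_measure, ← setLIntegral_univ (fun z : Euc N × Euc N => ENNReal.ofReal ((dist z.1 z.2 + 2 * δ) ^ p)),
    ← hRu, lintegral_iUnion hR hRd]
  refine ENNReal.tsum_le_tsum fun ij => ?_
  rw [lintegral_smul_measure, Measure.prod_restrict, smul_eq_mul]
  let K : ℝ≥0∞ := ⨅ z ∈ R ij, ENNReal.ofReal ((dist z.1 z.2 + 2 * δ) ^ p)
  have hK : ∀ w ∈ R ij, ENNReal.ofReal (dist w.1 w.2 ^ p) ≤ K := by
    intro w hw
    refine le_iInf₂ fun z hz => ENNReal.ofReal_le_ofReal ?_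
    refine Real.rpow_le_rpow dist_nonneg ?_ (by linarith)
    have e1 : dist w.1 z.1 ≤ δ := hd _ _ (hw.1.trans hz.1.symm)
    have e2 : dist z.2 w.2 ≤ δ := hd _ _ (hz.2.trans hw.2.symm)
    have := dist_triangle4 w.1 z.1 z.2 w.2
    linarith
  calc c ij * ∫⁻ z in R ij, ENNReal.ofReal (dist z.1 z.2 ^ p) ∂(μ'.prod ν')
      ≤ c ij * ∫⁻ z in R ij, K ∂(μ'.prod ν') := by
        gcongr 1
        exact setLIntegral_mono' (hR ij) hK
    _ = c ij * (K * (a ij.1 * b ij.2)) := by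
        rw [setLIntegral_const, Measure.prod_prod]
    _ = K * (c (ij.1, ij.2) * a ij.1 * b ij.2) := by ring
    _ = K * (π (R ij) * (b ij.2)⁻¹ * b ij.2) := by rw [hca]
    _ ≤ K * π (R ij) := by
        gcongr 1
        rw [mul_assoc]
        exact mul_le_of_le_one_right' (ENNReal.inv_mul_le_one _)
    _ = ∫⁻ z in R ij, K ∂π := by rw [setLIntegral_const]
    _ ≤ _ := setLIntegral_mono' (hR ij) fun z hz => iInf₂_le z hz

lemma densM_indicator {N : ℕ} (E : Set (Euc N)) (hE : MeasurableSet E) :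
    densM volume (E.indicator fun _ => (1 : ℝ)) = volume.restrict E := by
  unfold densM
  have : (fun x => ENNReal.ofReal (E.indicator (fun _ => (1:ℝ)) x)) = E.indicator 1 := by
    ext x; by_cases h : x ∈ E <;> simp [h]
  rw [this, withDensity_indicator_one hE]

lemma densM_add_le {N : ℕ} (ρ ρ' : Euc N → ℝ) (hm : Measurable ρ) (h0 : ∀ᵐ x, 0 ≤ ρ x)
    (h0' : ∀ x, 0 ≤ ρ' x) (h : ∀ᵐ x, ρ x + ρ' x ≤ 1) :
    densM volume ρ + densM volume ρ' ≤ volume := by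
  unfold densM
  rw [← withDensity_add_left (by fun_prop)]
  conv_rhs => rw [← withDensity_one (μ := (volume : Measure (Euc N)))]
  refine withDensity_mono ?_
  filter_upwards [h0, h] with x hx hx'
  simp only [Pi.add_apply, Pi.one_apply]
  rw [← ENNReal.ofReal_add hx (h0' x)]
  exact ENNReal.ofReal_le_one.2 hx'

lemma densM_univ_s8 {N : ℕ} (ρ : Euc N → ℝ) (hρ : memA volume 1 ρ) : densM volume ρ univ = 1 := by
  unfold densM
  rw [withDensity_apply _ .univ, setLIntegral_univ]
  have hi : Integrable ρ := by
    by_contra h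
    have := hρ.2.2
    rw [integral_undef h] at this; simp at this
  rw [← ofReal_integral_eq_lintegral_ofReal hi (hρ.2.1.mono fun x h => h.1), hρ.2.2]; simp

lemma integral_densM {N : ℕ} (ρ : Euc N → ℝ) (hρ : memA volume 1 ρ) (φ : Euc N → ℝ) :
    ∫ x, φ x ∂(densM volume ρ) = ∫ x, φ x * ρ x := by
  unfold densM
  rw [integral_withDensity_eq_integral_toReal_smul (by have := hρ.1; fun_prop) (by simp)]
  refine integral_congr_ae ?_
  filter_upwards [hρ.2.1] with x hx
  simp [ENNReal.toReal_ofReal hx.1, mul_comm]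

lemma weak_close {N : ℕ} (q : Euc N → ℕ) (hq : Measurable q) (δ : ℝ)
    (hd : ∀ x y, q x = q y → dist x y ≤ δ) (μ μ' : Measure (Euc N))
    [IsProbabilityMeasure μ] [IsProbabilityMeasure μ'] (h : μ'.map q = μ.map q)
    (φ : Euc N → ℝ) (hφ : Continuous φ) (hc : HasCompactSupport φ) (ε : ℝ)
    (hε : ∀ x y, dist x y ≤ δ → |φ x - φ y| ≤ ε) :
    |(∫ x, φ x ∂μ') - ∫ x, φ x ∂μ| ≤ 2 * ε := by
  obtain ⟨C, hC⟩ := hc.exists_bound_of_continuous hφ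
  let g : ℕ → ℝ := fun i => φ (Function.invFun q i)
  have hg : ∀ x, |φ x - g (q x)| ≤ ε := fun x =>
    hε _ _ (hd _ _ (Function.invFun_eq (f := q) ⟨x, rfl⟩).symm)
  have key : ∀ m : Measure (Euc N), IsProbabilityMeasure m →
      |(∫ x, φ x ∂m) - ∫ i, g i ∂(m.map q)| ≤ ε := by
    intro m hm
    have hgm : Measurable g := measurable_of_countable g
    rw [integral_map hq.aemeasurable hgm.aestronglyMeasurable]
    rw [← integral_sub]
    · have := norm_integral_le_of_norm_le_const (μ := m) (f := fun x => φ x - g (q x)) (C := ε)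
        (Eventually.of_forall hg)
      simpa using this
    · exact Integrable.of_bound hφ.aestronglyMeasurable C (Eventually.of_forall hC)
    · exact Integrable.of_bound (hgm.comp hq).aestronglyMeasurable C (Eventually.of_forall fun x => hC _)
  have k1 := key μ inferInstance
  have k2 := key μ' inferInstance
  rw [h] at k2
  rw [abs_le] at *
  constructor <;> linarith

lemma minkowski {N : ℕ} (p : ℝ) (hp : 1 < p) (δ : ℝ) (hδ : 0 < δ)
    (π : Measure (Euc N × Euc N)) [IsProbabilityMeasure π] :
    (∫⁻ z, ENNReal.ofReal ((dist z.1 z.2 + 2 * δ) ^ p) ∂π) ^ (1 / p)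
      ≤ tCost p π ^ (1 / p) + ENNReal.ofReal (2 * δ) := by
  have h := ENNReal.lintegral_Lp_add_le (μ := π) (p := p)
    (f := fun z : Euc N × Euc N => ENNReal.ofReal (dist z.1 z.2))
    (g := fun _ => ENNReal.ofReal (2 * δ)) (by fun_prop) (by fun_prop) hp.le
  have hp0 : 0 < p := by linarith
  simp only [Pi.add_apply] at h
  have e1 : ∀ z : Euc N × Euc N, (ENNReal.ofReal (dist z.1 z.2) + ENNReal.ofReal (2 * δ)) ^ p
      = ENNReal.ofReal ((dist z.1 z.2 + 2 * δ) ^ p) := fun z => by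
    rw [← ENNReal.ofReal_add dist_nonneg (by positivity), ENNReal.ofReal_rpow_of_nonneg (by positivity) hp0.le]
  have e2 : ∀ z : Euc N × Euc N, (ENNReal.ofReal (dist z.1 z.2)) ^ p
      = ENNReal.ofReal (dist z.1 z.2 ^ p) := fun z => by
    rw [ENNReal.ofReal_rpow_of_nonneg (by positivity) hp0.le]
  simp only [e1, e2, lintegral_const, measure_univ, mul_one] at h
  rw [← ENNReal.rpow_mul, mul_one_div_cancel hp0.ne', ENNReal.rpow_one] at h
  exact h

lemma recovery_step {N : ℕ} (hN : 1 ≤ N) (p : ℝ) (hp : 1 < p)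
    (ρ : Euc N → ℝ) (hρ : memA volume 1 ρ) (δ : ℝ) (hδ : 0 < δ) :
    ∃ E : Set (Euc N), MeasurableSet E ∧ volume E = 1 ∧
      (∀ φ : Euc N → ℝ, Continuous φ → HasCompactSupport φ → ∀ ε,
        (∀ x y, dist x y ≤ δ → |φ x - φ y| ≤ ε) →
        |(∫ x in E, φ x) - ∫ x, φ x * ρ x| ≤ 2 * ε) ∧
      WEnergy p volume (E.indicator fun _ => (1 : ℝ)) ≤
        (WEnergyPow p volume ρ + ENNReal.ofReal δ) ^ (1 / p) + ENNReal.ofReal (2 * δ) := by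
  have hp0 : 0 < p := by linarith
  obtain ⟨q, hq, hd, hf⟩ := exists_partition (N := N) δ hδ
  have hμ1 := densM_univ_s8 ρ hρ
  have : IsProbabilityMeasure (densM volume ρ) := ⟨hμ1⟩
  have main : ∀ ν : Measure (Euc N), densM volume ρ + ν ≤ volume →
    ∃ A B : Set (Euc N), MeasurableSet A ∧ MeasurableSet B ∧ Disjoint A B ∧
      (volume.restrict A).map q = (densM volume ρ).map q ∧ (volume.restrict B).map q = ν.map q ∧
      volume A = 1 ∧ (∀ φ : Euc N → ℝ, Continuous φ → HasCompactSupport φ → ∀ ε,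
        (∀ x y, dist x y ≤ δ → |φ x - φ y| ≤ ε) →
        |(∫ x in A, φ x) - ∫ x, φ x * ρ x| ≤ 2 * ε) := by
    intro ν hν
    obtain ⟨A, B, hA, hB, hAB, h1, h2⟩ := discretize hN q hq hf _ ν hν
    have hA1 : volume A = 1 := by
      have := congrArg (fun m => m univ) h1
      simp only [Measure.map_apply hq .univ, preimage_univ, Measure.restrict_apply_univ, hμ1] at this
      exact this
    have : IsProbabilityMeasure (volume.restrict A) := ⟨by simpa using hA1⟩
    refine ⟨A, B, hA, hB, hAB, h1, h2, hA1, ?_⟩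
    intro φ hφ hc ε hε
    rw [← integral_densM ρ hρ]
    exact weak_close q hq δ hd _ _ h1 φ hφ hc ε hε
  by_cases hfin : WEnergyPow p volume ρ = ∞
  · obtain ⟨A, B, hA, -, -, -, -, hA1, hw⟩ := main 0 (by
      have := densM_add_le ρ (fun _ => 0) hρ.1 (hρ.2.1.mono fun x h => h.1) (fun _ => le_rfl)
        (hρ.2.1.mono fun x h => by simpa using h.2)
      refine le_trans ?_ this
      gcongr
      exact Measure.zero_le _)
    refine ⟨A, hA, hA1, hw, ?_⟩
    rw [hfin, top_add, ENNReal.top_rpow_of_pos (by positivity), top_add]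
    exact le_top
  have hlt : WEnergyPow p volume ρ < WEnergyPow p volume ρ + ENNReal.ofReal δ :=
    ENNReal.lt_add_right hfin (by simpa using hδ)
  conv_lhs at hlt => unfold WEnergyPow
  simp only [iInf_lt_iff] at hlt
  obtain ⟨ρ', hadm, hlt⟩ := hlt
  unfold WpPow at hlt
  simp only [iInf_lt_iff] at hlt
  obtain ⟨π, hπ, hlt⟩ := hlt
  obtain ⟨hm', h0', hle, hmass⟩ := hadm
  obtain ⟨A, B, hA, hB, hAB, h1, h2, hA1, hw⟩ := main (densM volume ρ')
    (densM_add_le ρ ρ' hρ.1 (hρ.2.1.mono fun x h => h.1) h0' hle)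
  have hν1 : densM volume ρ' univ = 1 := by
    rw [← hμ1]; simpa [densM] using hmass
  have hB1 : volume B = 1 := by
    have := congrArg (fun m => m univ) h2
    simp only [Measure.map_apply hq .univ, preimage_univ, Measure.restrict_apply_univ, hν1] at this
    exact this
  have : IsProbabilityMeasure (volume.restrict A) := ⟨by simpa using hA1⟩
  have : IsProbabilityMeasure (volume.restrict B) := ⟨by simpa using hB1⟩
  have : IsProbabilityMeasure π := ⟨by
    have := congrArg (fun m => m univ) hπ.1
    simp only [Measure.map_apply measurable_fst .univ, preimage_univ, hμ1] at this
    exact this⟩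
  refine ⟨A, hA, hA1, hw, ?_⟩
  have hadm' : Adm volume (A.indicator fun _ => (1:ℝ)) (B.indicator fun _ => (1:ℝ)) := by
    refine ⟨measurable_const.indicator hB, fun x => indicator_nonneg (by simp) x,
      Eventually.of_forall fun x => ?_, ?_⟩
    · by_cases ha : x ∈ A
      · simp [ha, Set.disjoint_left.1 hAB ha]
      · simp only [ha, not_false_eq_true, indicator_of_notMem, zero_add]
        exact indicator_le_self' (fun _ _ => zero_le_one) x
    · have e1 := congrArg (fun m => m univ) (densM_indicator A hA)
      have e2 := congrArg (fun m => m univ) (densM_indicator B hB)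
      simp only [densM, withDensity_apply _ MeasurableSet.univ, setLIntegral_univ, Measure.restrict_apply_univ] at e1 e2
      rw [e1, e2, hA1, hB1]
  have step : WEnergyPow p volume (A.indicator fun _ => (1 : ℝ)) ≤
      ∫⁻ z, ENNReal.ofReal ((dist z.1 z.2 + 2 * δ) ^ p) ∂π := by
    refine (iInf₂_le _ hadm').trans ?_
    rw [densM_indicator A hA, densM_indicator B hB]
    exact plan_transfer p hp δ q hq hd hδ _ _ _ _ h1 h2 π hπ
  unfold WEnergy
  calc _ ≤ (∫⁻ z, ENNReal.ofReal ((dist z.1 z.2 + 2 * δ) ^ p) ∂π) ^ (1 / p) := by gcongr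
    _ ≤ tCost p π ^ (1 / p) + ENNReal.ofReal (2 * δ) := minkowski p hp δ hδ π
    _ ≤ _ := by gcongr

lemma liminf_add_le_of_forall (u v : ℕ → ℝ≥0∞) (V : ℝ≥0∞) (h : ∀ k, u k + v k ≤ V) :
    liminf u atTop + liminf v atTop ≤ V := by
  rw [liminf_eq_iSup_iInf_of_nat, liminf_eq_iSup_iInf_of_nat,
    ENNReal.iSup_add_iSup_of_monotone]
  · refine iSup_le fun n => (add_le_add (iInf₂_le n le_rfl) (iInf₂_le n le_rfl)).trans (h n)
  · intro a b hab
    exact le_iInf₂ fun i hi => iInf₂_le i (le_trans hab hi)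
  · intro a b hab
    exact le_iInf₂ fun i hi => iInf₂_le i (le_trans hab hi)

lemma tight_first {N : ℕ} (ρ : Euc N → ℝ) (hρ : memA volume 1 ρ)
    (E : ℕ → Set (Euc N)) (hE : ∀ n, MeasurableSet (E n)) (hE1 : ∀ n, volume (E n) = 1)
    (hconv : ∀ φ : Euc N → ℝ, Continuous φ → HasCompactSupport φ →
        Filter.Tendsto (fun n => ∫ x in E n, φ x) Filter.atTop (nhds (∫ x, φ x * ρ x)))
    (ε : ℝ) (hε : 0 < ε) :
    ∃ R : ℝ, ∀ᶠ n in atTop, volume.restrict (E n) {x | R < ‖x‖} ≤ ENNReal.ofReal ε := by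
  have hpr : IsProbabilityMeasure (densM volume ρ) := ⟨densM_univ_s8 ρ hρ⟩
  let φ : ℕ → Euc N → ℝ := fun j x => max 0 (min 1 (j + 1 - ‖x‖))
  have hφc : ∀ j, Continuous (φ j) := fun j => by fun_prop
  have hφ0 : ∀ j x, 0 ≤ φ j x := fun j x => le_max_left _ _
  have hφ1 : ∀ j x, φ j x ≤ 1 := fun j x => max_le zero_le_one (min_le_left _ _)
  have hφz : ∀ (j : ℕ) x, (j:ℝ) + 1 < ‖x‖ → φ j x = 0 := fun j x h =>
    max_eq_left ((min_le_right _ _).trans (by linarith))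
  have hφs : ∀ j, HasCompactSupport (φ j) := fun j => by
    refine HasCompactSupport.intro (isCompact_closedBall (0 : Euc N) (j + 1)) fun x hx => hφz j x ?_
    simpa using hx
  have hlim : Tendsto (fun j => ∫ x, φ j x ∂(densM volume ρ)) atTop (nhds (∫ x, (1:ℝ) ∂(densM volume ρ))) := by
    refine tendsto_integral_of_dominated_convergence (fun _ => 1) (fun j => (hφc j).aestronglyMeasurable)
      (integrable_const _) (fun j => Eventually.of_forall fun x => ?_) (Eventually.of_forall fun x => ?_)
    · rw [Real.norm_of_nonneg (hφ0 j x)]; exact hφ1 j x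
    · refine tendsto_const_nhds.congr' ?_
      filter_upwards [eventually_ge_atTop ⌈‖x‖⌉₊] with j hj
      have : ‖x‖ ≤ j := (Nat.le_ceil _).trans (by exact_mod_cast hj)
      simp only [φ]
      rw [min_eq_left (by linarith), max_eq_right zero_le_one]
  simp only [integral_const, probReal_univ, smul_eq_mul, mul_one] at hlim
  obtain ⟨j, hj⟩ := (hlim.eventually (lt_mem_nhds (show 1 - ε < 1 by linarith))).exists
  rw [integral_densM ρ hρ] at hj
  refine ⟨j + 1, ((hconv (φ j) (hφc j) (hφs j)).eventually (lt_mem_nhds hj)).mono fun n hn => ?_⟩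
  have : IsProbabilityMeasure (volume.restrict (E n)) := ⟨by simpa using hE1 n⟩
  have hms : MeasurableSet {x : Euc N | (j:ℝ) + 1 < ‖x‖} := measurableSet_lt (by fun_prop) (by fun_prop)
  have hle : ∫ x in E n, φ j x ≤ ∫ x in E n, ({x : Euc N | (j:ℝ) + 1 < ‖x‖}ᶜ).indicator (fun _ => (1:ℝ)) x := by
    refine integral_mono ?_ ?_ ?_
    · exact Integrable.of_bound (hφc j).aestronglyMeasurable 1 (Eventually.of_forall fun x => by
        rw [Real.norm_of_nonneg (hφ0 j x)]; exact hφ1 j x)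
    · exact (integrable_const _).indicator hms.compl
    · intro x
      by_cases h : (j:ℝ) + 1 < ‖x‖
      · simp [h, hφz j x h]
      · simpa [h] using hφ1 j x
  rw [integral_indicator_const _ hms.compl, smul_eq_mul, mul_one, probReal_compl_eq_one_sub hms] at hle
  rw [← ofReal_measureReal]
  exact ENNReal.ofReal_le_ofReal (by linarith)

lemma liminf_core {N : ℕ} (p : ℝ) (hp : 1 < p) (ρ : Euc N → ℝ) (hρ : memA volume 1 ρ)
    (E : ℕ → Set (Euc N)) (hE : ∀ n, MeasurableSet (E n)) (hE1 : ∀ n, volume (E n) = 1)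
    (hconv : ∀ φ : Euc N → ℝ, Continuous φ → HasCompactSupport φ →
        Filter.Tendsto (fun n => ∫ x in E n, φ x) Filter.atTop (nhds (∫ x, φ x * ρ x)))
    (c : ℝ≥0∞) (hc : c ≠ ∞)
    (hW : ∀ n, WEnergyPow p volume ((E n).indicator fun _ => (1 : ℝ)) < c) :
    WEnergyPow p volume ρ ≤ c := by
  have hp0 : 0 < p := by linarith
  have hex : ∀ n, ∃ π : Measure (Euc N × Euc N), π.map Prod.fst = volume.restrict (E n) ∧
      π.map Prod.fst + π.map Prod.snd ≤ volume ∧ tCost p π < c := by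
    intro n
    have hlt := hW n
    unfold WEnergyPow at hlt
    simp only [iInf_lt_iff] at hlt
    obtain ⟨ρ', hadm, hlt⟩ := hlt
    unfold WpPow at hlt
    simp only [iInf_lt_iff] at hlt
    obtain ⟨π, hπ, hlt⟩ := hlt
    refine ⟨π, by rw [hπ.1, densM_indicator _ (hE n)], ?_, hlt⟩
    rw [hπ.1, hπ.2]
    exact densM_add_le _ _ (measurable_const.indicator (hE n))
      (Eventually.of_forall fun x => indicator_nonneg (by simp) x) hadm.2.1 hadm.2.2.1
  choose π h1 h2 h3 using hex
  have hprob : ∀ n, IsProbabilityMeasure (π n) := fun n => ⟨by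
    have := congrArg (fun m => m univ) (h1 n)
    simp only [Measure.map_apply measurable_fst .univ, preimage_univ, Measure.restrict_apply_univ, hE1] at this
    exact this⟩
  have htight : IsTightMeasureSet (Set.range π) := by
    refine isTightMeasureSet_range_of_tendsto_limsup_measure_norm_gt ?_
    rw [ENNReal.tendsto_nhds_zero]
    intro ε hε
    obtain ⟨e, he0, heε⟩ : ∃ e : ℝ, 0 < e ∧ ENNReal.ofReal e + ENNReal.ofReal e ≤ ε := by
      by_cases ht : ε = ∞
      · exact ⟨1, one_pos, by simp [ht]⟩
      · have := ENNReal.toReal_pos hε.ne' ht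
        refine ⟨ε.toReal / 2, by positivity, ?_⟩
        rw [← ENNReal.ofReal_add (by positivity) (by positivity), add_halves, ENNReal.ofReal_toReal ht]
    obtain ⟨R, hR⟩ := tight_first ρ hρ E hE hE1 hconv e he0
    have hs : ∀ᶠ r : ℝ in atTop, c.toReal / e ≤ (r / 2) ^ p :=
      ((tendsto_rpow_atTop hp0).comp (tendsto_id.atTop_div_const (by norm_num : (0:ℝ) < 2))).eventually_ge_atTop _
    filter_upwards [hs, eventually_ge_atTop (2 * R), eventually_gt_atTop 0] with r hr hrR hr0
    refine limsup_le_of_le (by isBoundedDefault) (hR.mono fun n hn => ?_)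
    have hsub : {z : Euc N × Euc N | r < ‖z‖} ⊆ Prod.fst ⁻¹' {x | R < ‖x‖} ∪
        {z | ENNReal.ofReal ((r / 2) ^ p) ≤ ENNReal.ofReal (dist z.1 z.2 ^ p)} := by
      intro z hz
      by_contra hcon
      simp only [mem_union, mem_preimage, mem_ofPred_eq, not_or, not_lt, not_le] at hcon hz
      obtain ⟨a1, a2⟩ := hcon
      have a3 : dist z.1 z.2 < r / 2 := by
        by_contra h
        push Not at h
        exact absurd (ENNReal.ofReal_le_ofReal (Real.rpow_le_rpow (by positivity) h hp0.le)) (not_le.2 a2)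
      have a4 : ‖z.2‖ ≤ ‖z.1‖ + dist z.1 z.2 := by
        rw [dist_eq_norm]
        have := norm_sub_norm_le z.2 z.1
        rw [norm_sub_rev] at this; linarith
      have : ‖z‖ ≤ r := max_le (by linarith) (by linarith)
      linarith
    refine (measure_mono hsub).trans ((measure_union_le _ _).trans ((add_le_add ?_ ?_).trans heε))
    · rw [← Measure.map_apply measurable_fst (measurableSet_lt (by fun_prop) (by fun_prop)), h1]
      exact hn
    · have hpos : 0 < (r / 2) ^ p := by positivity
      refine (meas_ge_le_lintegral_div (by fun_prop) (by simpa using hpos) (by simp)).trans ?_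
      refine ENNReal.div_le_of_le_mul ((h3 n).le.trans ?_)
      rw [← ENNReal.ofReal_mul he0.le, ← ENNReal.ofReal_toReal hc]
      refine ENNReal.ofReal_le_ofReal ?_
      rw [div_le_iff₀ he0] at hr
      linarith
  let PM : ℕ → ProbabilityMeasure (Euc N × Euc N) := fun n => ⟨π n, hprob n⟩
  have hcpt : IsCompact (closure (Set.range PM)) := by
    refine isCompact_closure_of_isTightMeasureSet ?_
    convert htight using 1
    ext m
    constructor
    · rintro ⟨_, ⟨n, rfl⟩, rfl⟩
      exact ⟨n, rfl⟩
    · rintro ⟨n, rfl⟩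
      exact ⟨PM n, ⟨n, rfl⟩, rfl⟩
  obtain ⟨P, -, ns, hns, hlim⟩ := hcpt.tendsto_subseq (fun n => subset_closure (mem_range_self n))
  have hopen : ∀ G, IsOpen G → (P : Measure (Euc N × Euc N)) G ≤ liminf (fun k => π (ns k) G) atTop :=
    fun G hG => ProbabilityMeasure.le_liminf_measure_open_of_tendsto hlim hG
  have hcost : tCost p (P : Measure (Euc N × Euc N)) ≤ c := by
    have hcn : Continuous fun z : Euc N × Euc N => dist z.1 z.2 ^ p :=
      (continuous_fst.dist continuous_snd).rpow_const fun _ => Or.inr hp0.le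
    refine (lintegral_le_liminf_lintegral_of_forall_isOpen_measure_le_liminf_measure hcn
      (fun z => by positivity) hopen).trans ?_
    refine liminf_le_of_frequently_le' (Eventually.frequently (Eventually.of_forall fun k => (h3 _).le))
  have hfst : (P : Measure (Euc N × Euc N)).map Prod.fst = densM volume ρ := by
    have : IsProbabilityMeasure (densM volume ρ) := ⟨densM_univ_s8 ρ hρ⟩
    have : IsProbabilityMeasure ((P : Measure (Euc N × Euc N)).map Prod.fst) :=
      Measure.isProbabilityMeasure_map measurable_fst.aemeasurable
    refine Measure.ext_of_integral_eq_on_compactlySupported fun f => ?_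
    have hfc : Continuous (fun x => f x) := f.continuous
    rw [integral_densM ρ hρ, integral_map measurable_fst.aemeasurable hfc.aestronglyMeasurable]
    obtain ⟨C, hC⟩ := f.hasCompactSupport.exists_bound_of_continuous f.continuous
    let g : BoundedContinuousFunction (Euc N × Euc N) ℝ :=
      BoundedContinuousFunction.ofNormedAddCommGroup (fun z => f z.1) (f.continuous.comp continuous_fst) C
        (fun z => hC _)
    have hg := (ProbabilityMeasure.tendsto_iff_forall_integral_tendsto.1 hlim) g
    refine tendsto_nhds_unique hg ?_
    refine ((hconv f f.continuous f.hasCompactSupport).comp hns.tendsto_atTop).congr fun k => ?_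
    simp only [Function.comp]
    rw [← h1, integral_map measurable_fst.aemeasurable hfc.aestronglyMeasurable]
    rfl
  have hsum : (P : Measure (Euc N × Euc N)).map Prod.fst + (P : Measure (Euc N × Euc N)).map Prod.snd
      ≤ (volume : Measure (Euc N)) := by
    have hU : ∀ U : Set (Euc N), IsOpen U → ((P : Measure (Euc N × Euc N)).map Prod.fst +
        (P : Measure (Euc N × Euc N)).map Prod.snd) U ≤ volume U := by
      intro U hU
      rw [Measure.add_apply, Measure.map_apply measurable_fst hU.measurableSet,
        Measure.map_apply measurable_snd hU.measurableSet]
      refine (add_le_add (hopen _ (hU.preimage continuous_fst)) (hopen _ (hU.preimage continuous_snd))).trans ?_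
      refine liminf_add_le_of_forall _ _ _ fun k => ?_
      have := h2 (ns k) U
      rwa [Measure.add_apply, Measure.map_apply measurable_fst hU.measurableSet,
        Measure.map_apply measurable_snd hU.measurableSet] at this
    intro S
    rw [Set.measure_eq_iInf_isOpen S volume]
    exact le_iInf₂ fun U hSU => le_iInf fun hUo => (measure_mono hSU).trans (hU U hUo)
  set ν := (P : Measure (Euc N × Euc N)).map Prod.snd with hνdef
  have hνp : IsProbabilityMeasure ν := Measure.isProbabilityMeasure_map measurable_snd.aemeasurable
  have hνle : ν ≤ volume := le_trans (le_add_of_nonneg_left (Measure.zero_le _)) hsum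
  have hνac : ν ≪ volume := Measure.absolutelyContinuous_of_le hνle
  let ρ' : Euc N → ℝ := fun x => (ν.rnDeriv volume x).toReal
  have hae : (fun x => ENNReal.ofReal (ρ' x)) =ᵐ[volume] ν.rnDeriv volume := by
    filter_upwards [ν.rnDeriv_lt_top volume] with x hx
    exact ENNReal.ofReal_toReal hx.ne
  have hden : densM volume ρ' = ν := by
    unfold densM
    rw [withDensity_congr_ae hae, Measure.withDensity_rnDeriv_eq _ _ hνac]
  have hρ'm : Measurable ρ' := (Measure.measurable_rnDeriv _ _).ennreal_toReal
  have hadm : Adm volume ρ ρ' := by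
    refine ⟨hρ'm, fun x => ENNReal.toReal_nonneg, ?_, ?_⟩
    · rw [hfst, ← hden] at hsum
      have hρm := hρ.1
      have hle : (fun x => ENNReal.ofReal (ρ x) + ENNReal.ofReal (ρ' x)) ≤ᵐ[volume] fun _ => 1 := by
        refine ae_le_of_forall_setLIntegral_le_of_sigmaFinite (by fun_prop) fun s hs _ => ?_
        have := hsum s
        rw [Measure.add_apply, densM, densM, withDensity_apply _ hs, withDensity_apply _ hs,
          ← lintegral_add_left (by fun_prop)] at this
        simpa using this
      filter_upwards [hle, hρ.2.1] with x hx hx'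
      rw [← ENNReal.ofReal_add hx'.1 ENNReal.toReal_nonneg] at hx
      exact ENNReal.ofReal_le_one.1 hx
    · have e1 : densM volume ρ' univ = densM volume ρ univ := by
        rw [hden, densM_univ_s8 ρ hρ]; exact hνp.measure_univ
      simpa [densM] using e1
  refine (iInf₂_le ρ' hadm).trans ((iInf₂_le (P : Measure (Euc N × Euc N)) ⟨hfst, ?_⟩).trans hcost)
  rw [hden]

lemma liminf_part {N : ℕ} (p : ℝ) (hp : 1 < p) (ρ : Euc N → ℝ) (hρ : memA volume 1 ρ)
    (E : ℕ → Set (Euc N)) (hE : ∀ n, MeasurableSet (E n)) (hE1 : ∀ n, volume (E n) = 1)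
    (hconv : ∀ φ : Euc N → ℝ, Continuous φ → HasCompactSupport φ →
        Filter.Tendsto (fun n => ∫ x in E n, φ x) Filter.atTop (nhds (∫ x, φ x * ρ x))) :
    WEnergy p volume ρ ≤
        Filter.liminf (fun n => WEnergy p volume ((E n).indicator fun _ => (1 : ℝ)))
          Filter.atTop := by
  have hp0 : 0 < p := by linarith
  by_contra hcon
  push Not at hcon
  obtain ⟨a, ha1, ha2⟩ := exists_between hcon
  have hfr : ∃ᶠ n in atTop, WEnergy p volume ((E n).indicator fun _ => (1 : ℝ)) < a :=
    frequently_lt_of_liminf_lt (by isBoundedDefault) ha1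
  obtain ⟨ns, hns, hlt⟩ := extraction_of_frequently_atTop hfr
  have := liminf_core p hp ρ hρ (fun k => E (ns k)) (fun k => hE _) (fun k => hE1 _)
    (fun φ h1 h2 => (hconv φ h1 h2).comp hns.tendsto_atTop) (a ^ p)
    (ENNReal.rpow_ne_top_of_nonneg hp0.le ha2.ne_top) (fun k => by
      have := hlt k
      unfold WEnergy at this
      rw [one_div] at this
      exact (ENNReal.rpow_inv_lt_iff hp0).1 this)
  have : WEnergy p volume ρ ≤ a := by
    unfold WEnergy
    rw [one_div]
    exact (ENNReal.rpow_inv_le_iff hp0).2 this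
  exact absurd ha2 (not_lt.2 this)

/-- `𝒲_p` on `A` is the weak-* lower semicontinuous envelope of the set functional
`E ↦ 𝒲_p(χ_E)`: there is a recovery sequence of sets of volume `1` converging weakly-*
to `ρ` along which the energies converge, and along every such sequence the liminf of
the energies is at least `𝒲_p(ρ)`. -/
theorem relaxation_of_set_functional {N : ℕ} (hN : 1 ≤ N) (p : ℝ) (hp : 1 < p)
    (ρ : Euc N → ℝ) (hρ : memA volume 1 ρ) :
    (∃ E : ℕ → Set (Euc N), (∀ n, MeasurableSet (E n)) ∧ (∀ n, volume (E n) = 1) ∧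
      (∀ φ : Euc N → ℝ, Continuous φ → HasCompactSupport φ →
        Filter.Tendsto (fun n => ∫ x in E n, φ x) Filter.atTop (nhds (∫ x, φ x * ρ x))) ∧
      Filter.Tendsto (fun n => WEnergy p volume ((E n).indicator fun _ => (1 : ℝ)))
        Filter.atTop (nhds (WEnergy p volume ρ))) ∧
    (∀ E : ℕ → Set (Euc N), (∀ n, MeasurableSet (E n)) → (∀ n, volume (E n) = 1) →
      (∀ φ : Euc N → ℝ, Continuous φ → HasCompactSupport φ →
        Filter.Tendsto (fun n => ∫ x in E n, φ x) Filter.atTop (nhds (∫ x, φ x * ρ x))) →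
      WEnergy p volume ρ ≤
        Filter.liminf (fun n => WEnergy p volume ((E n).indicator fun _ => (1 : ℝ)))
          Filter.atTop) := by
  have hp0 : 0 < p := by linarith
  refine ⟨?_, fun E hE hE1 hconv => liminf_part p hp ρ hρ E hE hE1 hconv⟩
  have hδ : ∀ n : ℕ, (0:ℝ) < 1 / ((n:ℝ) + 1) := fun n => by positivity
  have hδ0 : Tendsto (fun n : ℕ => 1 / ((n:ℝ) + 1)) atTop (nhds 0) :=
    tendsto_one_div_add_atTop_nhds_zero_nat
  choose E hE hE1 hw hW using fun n : ℕ => recovery_step hN p hp ρ hρ _ (hδ n)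
  have hconv : ∀ φ : Euc N → ℝ, Continuous φ → HasCompactSupport φ →
        Filter.Tendsto (fun n => ∫ x in E n, φ x) Filter.atTop (nhds (∫ x, φ x * ρ x)) := by
    intro φ hφ hc
    rw [Metric.tendsto_atTop']
    intro ε hε
    obtain ⟨d, hd, hu⟩ := Metric.uniformContinuous_iff.1 (hc.uniformContinuous_of_continuous hφ) (ε / 4) (by positivity)
    obtain ⟨n0, hn0⟩ := eventually_atTop.1 (hδ0.eventually (gt_mem_nhds hd))
    refine ⟨n0, fun n hn => ?_⟩
    have := hw n φ hφ hc (ε / 4) (fun x y hxy => (hu (hxy.trans_lt (hn0 n hn.le))).le)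
    rw [Real.dist_eq]
    linarith
  refine ⟨E, hE, hE1, hconv, ?_⟩
  have hlow := liminf_part p hp ρ hρ E hE hE1 hconv
  have hup : Tendsto (fun n : ℕ => (WEnergyPow p volume ρ + ENNReal.ofReal (1 / ((n:ℝ) + 1))) ^ (1 / p) +
      ENNReal.ofReal (2 * (1 / ((n:ℝ) + 1)))) atTop (nhds (WEnergy p volume ρ)) := by
    have t1 : Tendsto (fun n : ℕ => ENNReal.ofReal (1 / ((n:ℝ) + 1))) atTop (nhds 0) := by
      simpa using ENNReal.tendsto_ofReal hδ0
    have t2 : Tendsto (fun n : ℕ => ENNReal.ofReal (2 * (1 / ((n:ℝ) + 1)))) atTop (nhds 0) := by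
      simpa using ENNReal.tendsto_ofReal (hδ0.const_mul 2)
    have t3 := ((ENNReal.continuous_rpow_const (y := 1 / p)).tendsto _).comp
      (tendsto_const_nhds (x := WEnergyPow p volume ρ) |>.add t1)
    have := t3.add t2
    simpa [WEnergy] using this
  refine tendsto_of_le_liminf_of_limsup_le hlow ?_
  rw [← hup.limsup_eq]
  exact limsup_le_limsup (Eventually.of_forall hW)
end
end

section
/- Let p>1, let ρ ∈ A, and let F: ℝ^N → ℝ^N be an isometry such that F_#(ρℒ^N) = ρℒ^N. Let η_ρ be the unique density in A with ρ+η_ρ ≤ 1 realizing 𝒲_p(ρ) = W_p(ρℒ^N, η_ρℒ^N), and let π_ρ be the unique optimal transport plan between ρℒ^N and η_ρℒ^N. Then F_#(η_ρ ℒ^N) = η_ρ ℒ^N and F̃_#π_ρ = π_ρ, where F̃(x,y) = (F(x), F(y)). -/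
open MeasureTheory ENNReal Set Metric Filter

noncomputable section

lemma swap_mono {N : ℕ} (p : ℝ) (m : Measure (Euc N × Euc N)) [IsProbabilityMeasure m]
    (h : ∀ m' : Measure (Euc N × Euc N), m'.map Prod.fst = m.map Prod.fst →
      m'.map Prod.snd = m.map Prod.snd → tCost p m ≤ tCost p m') (hfin : tCost p m ≠ ⊤) :
    ∀ᵐ w ∂(m.prod m), ENNReal.ofReal (dist w.1.1 w.1.2 ^ p) + ENNReal.ofReal (dist w.2.1 w.2.2 ^ p)
      ≤ ENNReal.ofReal (dist w.1.1 w.2.2 ^ p) + ENNReal.ofReal (dist w.2.1 w.1.2 ^ p) := by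
  classical
  let C : Euc N × Euc N → ℝ≥0∞ := fun z => ENNReal.ofReal (dist z.1 z.2 ^ p)
  have hC : Measurable C := by
    refine ENNReal.measurable_ofReal.comp ?_
    exact (measurable_fst.dist measurable_snd).pow_const p
  let W := (Euc N × Euc N) × (Euc N × Euc N)
  let f : W → ℝ≥0∞ := fun w => C w.1 + C w.2
  let k : W → ℝ≥0∞ := fun w => C (w.1.1, w.2.2) + C (w.2.1, w.1.2)
  have hf : Measurable f := (hC.comp measurable_fst).add (hC.comp measurable_snd)
  have hk : Measurable k := (hC.comp (by fun_prop)).add (hC.comp (by fun_prop))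
  let S : Set W := {w | k w < f w}
  have hS : MeasurableSet S := measurableSet_lt hk hf
  have hSs : ∀ w : W, w.swap ∈ S ↔ w ∈ S := by
    intro w
    change C (w.2.1, w.1.2) + C (w.1.1, w.2.2) < C w.2 + C w.1 ↔
      C (w.1.1, w.2.2) + C (w.2.1, w.1.2) < C w.1 + C w.2
    rw [add_comm (C w.2), add_comm (C (w.2.1, w.1.2))]
  let T : W → Euc N × Euc N := fun w => if w ∈ S then (w.1.1, w.2.2) else w.1
  have hT : Measurable T := Measurable.ite hS (by fun_prop) (by fun_prop)
  have hsw : MeasurePreserving Prod.swap (m.prod m) (m.prod m) := Measure.measurePreserving_swap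
  have hfst : ∀ g : Euc N × Euc N → ℝ≥0∞, Measurable g →
      ∫⁻ w, g w.1 ∂(m.prod m) = ∫⁻ z, g z ∂m := fun g hg =>
    (measurePreserving_fst (μ := m) (ν := m)).lintegral_comp hg
  have hsnd : ∀ g : Euc N × Euc N → ℝ≥0∞, Measurable g →
      ∫⁻ w, g w.2 ∂(m.prod m) = ∫⁻ z, g z ∂m := fun g hg =>
    (measurePreserving_snd (μ := m) (ν := m)).lintegral_comp hg
  let m' := (m.prod m).map T
  have h1 : m'.map Prod.fst = m.map Prod.fst := by
    rw [Measure.map_map measurable_fst hT]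
    have : Prod.fst ∘ T = Prod.fst ∘ Prod.fst := by
      funext w; simp only [T, Function.comp]; split_ifs <;> rfl
    rw [this, ← Measure.map_map measurable_fst measurable_fst, Measure.map_fst_prod]
    simp
  have h2 : m'.map Prod.snd = m.map Prod.snd := by
    refine Measure.ext_of_lintegral _ fun g hg => ?_
    rw [lintegral_map hg measurable_snd, lintegral_map hg measurable_snd]
    have e0 : ∫⁻ a, g a.2 ∂m' = ∫⁻ w, g (T w).2 ∂(m.prod m) :=
      lintegral_map (hg.comp measurable_snd) hT
    rw [e0]
    have e1 : ∀ w, g (T w).2 = S.indicator (fun w => g w.2.2) w + Sᶜ.indicator (fun w => g w.1.2) w := by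
      intro w
      by_cases hw : w ∈ S <;> simp [T, hw]
    have e2 : ∀ w, g w.1.2 = S.indicator (fun w => g w.1.2) w + Sᶜ.indicator (fun w => g w.1.2) w := by
      intro w
      by_cases hw : w ∈ S <;> simp [hw]
    have m1 : Measurable (S.indicator (fun w : W => g w.2.2)) :=
      (hg.comp (by fun_prop : Measurable fun w : W => w.2.2)).indicator hS
    have m2 : Measurable (S.indicator (fun w : W => g w.1.2)) :=
      (hg.comp (by fun_prop : Measurable fun w : W => w.1.2)).indicator hS
    rw [← hfst (fun z => g z.2) (hg.comp measurable_snd)]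
    simp_rw [e1]
    conv_rhs => enter [2, w]; rw [e2 w]
    rw [lintegral_add_left m1, lintegral_add_left m2]
    congr 1
    rw [← hsw.lintegral_comp m1]
    refine lintegral_congr fun w => ?_
    by_cases hw : w ∈ S
    · rw [indicator_of_mem hw, indicator_of_mem ((hSs w).2 hw)]; rfl
    · rw [indicator_of_notMem hw, indicator_of_notMem (fun h => hw ((hSs w).1 h))]
  have hle := h m' h1 h2
  let g : W → ℝ≥0∞ := fun w => C (T w) + C (T w.swap)
  have hg : Measurable g := (hC.comp hT).add (hC.comp (hT.comp measurable_swap))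
  have hgS : ∀ w ∈ S, g w = k w := by
    intro w hw
    simp only [g, T, hw, (hSs w).2 hw, if_true]; rfl
  have hgSc : ∀ w, w ∉ S → g w = f w := by
    intro w hw
    have := mt (hSs w).1 hw
    simp only [g, T, hw, this, if_false]; rfl
  have hgf : g ≤ f := by
    intro w
    by_cases hw : w ∈ S
    · rw [hgS w hw]; exact le_of_lt hw
    · rw [hgSc w hw]
  have If : ∫⁻ w, f w ∂(m.prod m) = tCost p m + tCost p m := by
    have e : ∫⁻ w, f w ∂(m.prod m) = ∫⁻ w, C w.1 ∂(m.prod m) + ∫⁻ w, C w.2 ∂(m.prod m) :=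
      lintegral_add_left (hC.comp measurable_fst) _
    rw [e, hfst C hC, hsnd C hC]; rfl
  have Ig : ∫⁻ w, g w ∂(m.prod m) = tCost p m' + tCost p m' := by
    have e : tCost p m' = ∫⁻ w, C (T w) ∂(m.prod m) := lintegral_map hC hT
    have e' : ∫⁻ w, g w ∂(m.prod m) = ∫⁻ w, C (T w) ∂(m.prod m) +
        ∫⁻ w, C (T w.swap) ∂(m.prod m) := lintegral_add_left (hC.comp hT) _
    rw [e', e]
    congr 1
    exact hsw.lintegral_comp (hC.comp hT)
  have hae : g =ᵐ[m.prod m] f := by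
    refine ae_eq_of_ae_le_of_lintegral_le (Eventually.of_forall hgf) ?_ hf.aemeasurable ?_
    · refine ne_top_of_le_ne_top ?_ (lintegral_mono hgf)
      rw [If]; exact ENNReal.add_ne_top.2 ⟨hfin, hfin⟩
    · rw [If, Ig]; gcongr
  filter_upwards [hae] with w hw
  by_contra hcon
  have hwS : w ∈ S := not_le.1 hcon
  rw [hgS w hwS] at hw
  have hlt : k w < f w := hwS
  exact absurd hlt (by rw [hw]; exact lt_irrefl _)

lemma supp_mono {N : ℕ} (p : ℝ) (hp : 1 < p) (m : Measure (Euc N × Euc N)) [IsProbabilityMeasure m]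
    (h : ∀ᵐ w ∂(m.prod m),
      ENNReal.ofReal (dist w.1.1 w.1.2 ^ p) + ENNReal.ofReal (dist w.2.1 w.2.2 ^ p)
      ≤ ENNReal.ofReal (dist w.1.1 w.2.2 ^ p) + ENNReal.ofReal (dist w.2.1 w.1.2 ^ p))
    (x y x' y' : Euc N) (h1 : (x, y) ∈ m.support) (h2 : (x', y') ∈ m.support) :
    ‖x - y‖ ^ p + ‖x' - y'‖ ^ p ≤ ‖x - y'‖ ^ p + ‖x' - y‖ ^ p := by
  by_contra! hcon
  let W := (Euc N × Euc N) × (Euc N × Euc N)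
  let S : Set W := {w | ‖w.1.1 - w.2.2‖ ^ p + ‖w.2.1 - w.1.2‖ ^ p
    < ‖w.1.1 - w.1.2‖ ^ p + ‖w.2.1 - w.2.2‖ ^ p}
  have hc : ∀ f : W → Euc N, Continuous f → Continuous fun w => ‖f w‖ ^ p := fun f hf =>
    hf.norm.rpow_const fun _ => Or.inr (by linarith)
  have hS : IsOpen S := isOpen_lt
    ((hc _ (by fun_prop)).add (hc _ (by fun_prop))) ((hc _ (by fun_prop)).add (hc _ (by fun_prop)))
  have hmem : (((x, y), (x', y')) : W) ∈ S := hcon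
  have hn := hS.mem_nhds hmem
  rw [nhds_prod_eq, mem_prod_iff] at hn
  obtain ⟨U, hU, V, hV, hUV⟩ := hn
  have pU := (Measure.mem_support_iff_forall _).1 h1 U hU
  have pV := (Measure.mem_support_iff_forall _).1 h2 V hV
  have h0 : (m.prod m) S = 0 := by
    refine measure_mono_null ?_ h
    intro w hw
    simp only [mem_compl_iff, mem_ofPred_eq, not_le]
    rw [← ENNReal.ofReal_add (by positivity) (by positivity),
      ← ENNReal.ofReal_add (by positivity) (by positivity)]
    simp only [dist_eq_norm]
    exact (ENNReal.ofReal_lt_ofReal_iff_of_nonneg (by positivity)).2 hw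
  have := measure_mono_null hUV h0
  rw [Measure.prod_prod] at this
  exact mul_ne_zero pU.ne' pV.ne' this

lemma grad_pos {N : ℕ} (p : ℝ) (hp : 1 < p) (a b : Euc N) (hab : a ≠ b) :
    0 < ((p * ‖a‖ ^ (p - 2)) • innerSL ℝ a) (a - b) - ((p * ‖b‖ ^ (p - 2)) • innerSL ℝ b) (a - b) := by
  simp only [smul_apply, innerSL_apply_apply, smul_eq_mul, inner_sub_right,
    real_inner_self_eq_norm_sq, real_inner_comm a b]
  have key : ∀ t : ℝ, 0 ≤ t → t ^ (p - 2) * t = t ^ (p - 1) := by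
    intro t ht
    rw [← Real.rpow_add_one' ht (by linarith)]; congr 1; ring
  have ka := key _ (norm_nonneg a)
  have kb := key _ (norm_nonneg b)
  have hcs := real_inner_le_norm a b
  have hα : 0 ≤ ‖a‖ ^ (p - 2) := by positivity
  have hβ : 0 ≤ ‖b‖ ^ (p - 2) := by positivity
  have hp0 : 0 < p := by linarith
  have main : 0 < ‖a‖ ^ (p - 2) * ‖a‖ ^ 2 - (‖a‖ ^ (p - 2) + ‖b‖ ^ (p - 2)) * inner ℝ a b
      + ‖b‖ ^ (p - 2) * ‖b‖ ^ 2 := by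
    by_cases hn : ‖a‖ = ‖b‖
    · have hpos : 0 < ‖a‖ := by
        rcases (norm_nonneg a).eq_or_lt with h | h
        · exfalso; apply hab
          rw [norm_eq_zero.1 h.symm, norm_eq_zero.1 (hn.symm.trans h.symm)]
        · exact h
      have h2 : 0 < ‖a - b‖ ^ 2 := by
        have := norm_pos_iff.2 (sub_ne_zero.2 hab); positivity
      rw [norm_sub_sq_real] at h2
      rw [← hn] at h2 ⊢
      have : 0 < ‖a‖ ^ (p - 2) := by positivity
      nlinarith
    · have hm : 0 < (‖a‖ ^ (p - 1) - ‖b‖ ^ (p - 1)) * (‖a‖ - ‖b‖) := by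
        rcases lt_or_gt_of_ne hn with h | h
        · have := Real.rpow_lt_rpow (norm_nonneg a) h (by linarith : 0 < p - 1)
          exact mul_pos_of_neg_of_neg (by linarith) (by linarith)
        · have := Real.rpow_lt_rpow (norm_nonneg b) h (by linarith : 0 < p - 1)
          exact mul_pos (by linarith) (by linarith)
      rw [← ka, ← kb] at hm
      nlinarith [mul_nonneg (add_nonneg hα hβ) (sub_nonneg.2 hcs)]
  nlinarith [mul_pos hp0 main]

lemma local_sep {N : ℕ} (p : ℝ) (hp : 1 < p) (x₀ y₀ y₁ : Euc N) (hne : y₀ ≠ y₁) :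
    ∃ r > 0, ∀ (x : Euc N) (t : ℝ), 0 < t → x ∈ closedBall x₀ r →
      x + t • (y₁ - y₀) ∈ closedBall x₀ r →
      ∀ y ∈ closedBall y₀ r, ∀ y' ∈ closedBall y₁ r,
      ‖x - y‖ ^ p + ‖x + t • (y₁ - y₀) - y'‖ ^ p < ‖x + t • (y₁ - y₀) - y‖ ^ p + ‖x - y'‖ ^ p := by
  set w := y₁ - y₀ with hw
  have hw0 : 0 < ‖w‖ := norm_pos_iff.2 (sub_ne_zero.2 hne.symm)
  set a := x₀ - y₀ with ha
  set b := x₀ - y₁ with hb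
  have hab : a - b = w := by simp only [ha, hb, hw]; abel
  have hne' : a ≠ b := by rw [← sub_ne_zero, hab]; exact norm_pos_iff.1 hw0
  have hg := grad_pos p hp a b hne'
  rw [hab] at hg
  set A := (p * ‖a‖ ^ (p - 2)) • innerSL ℝ a
  set B := (p * ‖b‖ ^ (p - 2)) • innerSL ℝ b
  have st : ∀ z : Euc N, HasStrictFDerivAt (fun x : Euc N => ‖x‖ ^ p)
      ((p * ‖z‖ ^ (p - 2)) • innerSL ℝ z) z := fun z =>
    (contDiff_norm_rpow hp).contDiffAt.hasStrictFDerivAt' (hasFDerivAt_norm_rpow z hp) (by simp)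
  set ε := (A w - B w) / (4 * ‖w‖) with hε
  have hε0 : 0 < ε := by positivity
  have hεw : ε * ‖w‖ * 4 = A w - B w := by rw [hε]; field_simp
  have ea := (st a).isLittleO.def hε0
  have eb := (st b).isLittleO.def hε0
  rw [Metric.eventually_nhds_iff] at ea eb
  obtain ⟨ra, hra, ea⟩ := ea
  obtain ⟨rb, hrb, eb⟩ := eb
  refine ⟨min ra rb / 4, by positivity, ?_⟩
  intro x t ht hx hx' y hy y' hy'
  have hr : min ra rb / 4 + min ra rb / 4 < min ra rb := by
    have : 0 < min ra rb := lt_min hra hrb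
    linarith
  have d : ∀ u ∈ closedBall x₀ (min ra rb / 4), ∀ v v₀ : Euc N,
      v ∈ closedBall v₀ (min ra rb / 4) → dist (u - v) (x₀ - v₀) < min ra rb := by
    intro u hu v v₀ hv
    exact lt_of_le_of_lt (dist_sub_sub_le _ _ _ _) (lt_of_le_of_lt (add_le_add hu hv) hr)
  have ha1 := @ea (x + t • w - y, x - y) (by
    rw [Prod.dist_eq]
    exact max_lt ((d _ hx' _ _ hy).trans_le (min_le_left _ _))
      ((d _ hx _ _ hy).trans_le (min_le_left _ _)))
  have hb1 := @eb (x + t • w - y', x - y') (by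
    rw [Prod.dist_eq]
    exact max_lt ((d _ hx' _ _ hy').trans_le (min_le_right _ _))
      ((d _ hx _ _ hy').trans_le (min_le_right _ _)))
  have s1 : ∀ v : Euc N, x + t • w - v - (x - v) = t • w := by intro v; abel
  simp only [s1, map_smul, norm_smul, smul_eq_mul, Real.norm_eq_abs, abs_of_pos ht] at ha1 hb1
  have l1 := (abs_le.1 ha1).1
  have l2 := (abs_le.1 hb1).2
  have : t * (ε * ‖w‖ * 4) = t * A w - t * B w := by rw [hεw]; ring
  have : 0 < t * (ε * ‖w‖) := by positivity
  nlinarith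

open scoped Pointwise in
lemma graph_null {N : ℕ} (p : ℝ) (hp : 1 < p) (Γ : Set (Euc N × Euc N)) (hΓ : IsClosed Γ)
    (hm : ∀ x y x' y' : Euc N, (x, y) ∈ Γ → (x', y') ∈ Γ →
      ‖x - y‖ ^ p + ‖x' - y'‖ ^ p ≤ ‖x - y'‖ ^ p + ‖x' - y‖ ^ p) :
    volume {x : Euc N | ∃ y y', y ≠ y' ∧ (x, y) ∈ Γ ∧ (x, y') ∈ Γ} = 0 := by
  have loc : ∀ z : Euc N × Euc N × Euc N, z.2.1 ≠ z.2.2 → ∃ r > 0,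
      volume (Prod.fst '' (Γ ∩ closedBall z.1 r ×ˢ closedBall z.2.1 r) ∩
        Prod.fst '' (Γ ∩ closedBall z.1 r ×ˢ closedBall z.2.2 r)) = 0 := by
    rintro ⟨x₀, y₀, y₁⟩ hne
    obtain ⟨r, hr, H⟩ := local_sep p hp x₀ y₀ y₁ hne
    refine ⟨r, hr, ?_⟩
    have cpt : ∀ v : Euc N, IsCompact (Prod.fst '' (Γ ∩ closedBall x₀ r ×ˢ closedBall v r)) :=
      fun v => (((isCompact_closedBall x₀ r).prod (isCompact_closedBall v r)).inter_left hΓ).image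
        continuous_fst
    set w := y₁ - y₀ with hw
    set K := Prod.fst '' (Γ ∩ closedBall x₀ r ×ˢ closedBall y₀ r) ∩
        Prod.fst '' (Γ ∩ closedBall x₀ r ×ˢ closedBall y₁ r) with hK
    have key : ∀ (x : Euc N) (t : ℝ), 0 < t → x ∈ K → x + t • w ∈ K → False := by
      rintro x t ht ⟨-, ⟨⟨a, y'⟩, ⟨hΓ1, hx, hy'⟩, rfl⟩⟩ ⟨⟨⟨b, y⟩, ⟨hΓ2, hx', hy⟩, hb⟩, -⟩
      simp only at hb hx hy' hx' hy
      subst hb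
      have h1 := H a t ht hx hx' y hy y' hy'
      have h2 := hm _ _ _ _ hΓ1 hΓ2
      linarith
    refine Measure.addHaar_eq_zero_of_disjoint_translates volume
      (fun n : ℕ => ((1 : ℝ) / (n + 1)) • w) ?_ ?_ ((cpt _).inter (cpt _)).measurableSet
    · refine (Bornology.IsBounded.subset (isBounded_closedBall (x := (0 : Euc N)) (r := ‖w‖))) ?_
      rintro _ ⟨n, rfl⟩
      simp only [mem_closedBall, dist_zero_right, norm_smul]
      have h1 : ‖(1 : ℝ) / (n + 1)‖ ≤ 1 := by
        rw [Real.norm_of_nonneg (by positivity), div_le_one (by positivity)]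
        have : (0 : ℝ) ≤ n := by positivity
        linarith
      nlinarith [norm_nonneg w]
    · have dis : ∀ s t : ℝ, s < t → Disjoint ({s • w} + K) ({t • w} + K) := by
        intro s t hst
        rw [Set.disjoint_left]
        rintro _ ⟨_, rfl, k, hk, rfl⟩ ⟨_, rfl, k', hk', he⟩
        simp only at he
        refine key k' (t - s) (sub_pos.2 hst) hk' ?_
        have : k' + (t - s) • w = k := by
          rw [sub_smul]
          have : t • w + k' = s • w + k := he
          have h3 : k = t • w + k' - s • w := by rw [this]; abel
          rw [h3]; abel
        rw [this]; exact hk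
      intro n m hnm
      have : (1 : ℝ) / (n + 1) ≠ 1 / (m + 1) := by
        intro h
        rw [div_eq_div_iff (by positivity) (by positivity)] at h
        apply hnm
        have : (m : ℝ) = n := by linarith
        exact_mod_cast this.symm
      rcases lt_or_gt_of_ne this with h | h
      · exact dis _ _ h
      · exact (dis _ _ h).symm
  choose! r hr hz using loc
  let D : Set (Euc N × Euc N × Euc N) := {z | z.2.1 ≠ z.2.2}
  obtain ⟨t, htD, htc, hcov⟩ := TopologicalSpace.countable_cover_nhdsWithin (s := D)
    (f := fun z => closedBall z (r z))
    (fun z hz => mem_nhdsWithin_of_mem_nhds (closedBall_mem_nhds z (hr z hz)))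
  refine measure_mono_null ?_ ((measure_biUnion_null_iff htc).2 fun z hzt => hz z (htD hzt))
  rintro x ⟨y, y', hne, h1, h2⟩
  have := hcov (show (x, y, y') ∈ D from hne)
  simp only [mem_iUnion] at this ⊢
  obtain ⟨z, hzt, hxz⟩ := this
  refine ⟨z, hzt, ?_⟩
  rw [mem_closedBall, Prod.dist_eq, Prod.dist_eq] at hxz
  simp only [max_le_iff] at hxz
  exact ⟨⟨(x, y), ⟨h1, hxz.1, hxz.2.1⟩, rfl⟩, ⟨(x, y'), ⟨h2, hxz.1, hxz.2.2⟩, rfl⟩⟩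

lemma eq_of_graph {N : ℕ} (Γ : Set (Euc N × Euc N)) (hΓ : IsClosed Γ)
    (hn : volume {x : Euc N | ∃ y y', y ≠ y' ∧ (x, y) ∈ Γ ∧ (x, y') ∈ Γ} = 0)
    (π π' : Measure (Euc N × Euc N)) (h1 : π Γᶜ = 0) (h2 : π' Γᶜ = 0)
    (hfst : π.map Prod.fst = π'.map Prod.fst) (hac : π.map Prod.fst ≪ volume) : π = π' := by
  obtain ⟨Z, hBZ, hZ, hZ0⟩ := exists_measurable_superset_of_null hn
  have hZπ : ∀ μ : Measure (Euc N × Euc N), μ.map Prod.fst = π.map Prod.fst →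
      μ Γᶜ = 0 → ∀ A, MeasurableSet A →
      μ A = (π.map Prod.fst) (Prod.fst '' (A ∩ (Γ ∩ Prod.fst ⁻¹' Zᶜ))) := by
    intro μ hμ hμΓ A hA
    set G := Γ ∩ (Prod.fst : Euc N × Euc N → Euc N) ⁻¹' Zᶜ with hG
    have hGm : MeasurableSet G := hΓ.measurableSet.inter (measurable_fst hZ.compl)
    have inj : InjOn (Prod.fst : Euc N × Euc N → Euc N) G := by
      rintro ⟨x, y⟩ ⟨ha, hb⟩ ⟨x', y'⟩ ⟨ha', hb'⟩ h
      simp only at h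
      subst h
      by_contra hne
      refine hb (hBZ ⟨y, y', fun h => hne (by rw [h]), ha, ha'⟩)
    have him : MeasurableSet (Prod.fst '' (A ∩ G)) :=
      (hA.inter hGm).image_of_measurable_injOn measurable_fst (inj.mono inter_subset_right)
    have hGc : μ Gᶜ = 0 := by
      rw [hG, compl_inter]
      refine measure_union_null hμΓ ?_
      rw [preimage_compl, compl_compl, ← Measure.map_apply measurable_fst hZ, hμ]
      exact hac hZ0
    rw [← hμ, Measure.map_apply measurable_fst him]
    rw [← measure_inter_conull hGc (s := A),
      ← measure_inter_conull hGc (s := Prod.fst ⁻¹' (Prod.fst '' (A ∩ G)))]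
    congr 1
    ext z
    constructor
    · rintro hz; exact ⟨⟨z, hz, rfl⟩, hz.2⟩
    · rintro ⟨⟨z', hz', he⟩, hzG⟩
      rw [← inj hz'.2 hzG he]; exact hz'
  ext A hA
  rw [hZπ π rfl h1 A hA, hZπ π' hfst.symm h2 A hA]

lemma energy_fin {N : ℕ} (p : ℝ) (hp : 1 < p) (ρ : Euc N → ℝ) (hρ : memA volume 1 ρ)
    (hr1 : ∫⁻ x, ENNReal.ofReal (ρ x) = 1)
    (R : ℝ) (hR : 2 ≤ volume (ball (0 : Euc N) R)) : WEnergyPow p volume ρ ≠ ⊤ := by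
  obtain ⟨hρm, hρ01, -⟩ := hρ
  let r : Euc N → ℝ≥0∞ := fun x => ENNReal.ofReal (ρ x)
  let s : Euc N → ℝ≥0∞ := fun x => ENNReal.ofReal (1 - ρ x)
  have hr : Measurable r := ENNReal.measurable_ofReal.comp hρm
  have hs : Measurable s := ENNReal.measurable_ofReal.comp (measurable_const.sub hρm)
  have hrs : ∀ᵐ x, s x + r x = 1 := by
    filter_upwards [hρ01] with x hx
    simp only [r, s]
    rw [← ENNReal.ofReal_add (by linarith) hx.1]; simp
  let I : Euc N × Euc N → ℝ≥0∞ := {z : Euc N × Euc N | dist z.1 z.2 < R}.indicator 1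
  have hI : Measurable I := measurable_one.indicator
    (measurableSet_lt (measurable_fst.dist measurable_snd) measurable_const)
  have hI1 : ∀ z, I z ≤ 1 := fun z => indicator_le_self' (fun _ _ => zero_le) z
  have hIball : ∀ x (g : Euc N → ℝ≥0∞), ∫⁻ y, I (x, y) * g y = ∫⁻ y in ball x R, g y := by
    intro x g
    rw [← lintegral_indicator measurableSet_ball]
    refine lintegral_congr fun y => ?_
    by_cases h : dist x y < R
    · rw [indicator_of_mem (by rwa [mem_ball, dist_comm])]
      simp [I, h]
    · rw [indicator_of_notMem (by rwa [mem_ball, dist_comm])]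
      simp [I, h]
  let a : Euc N → ℝ≥0∞ := fun x => ∫⁻ y, I (x, y) * s y
  have ha : Measurable a := (hI.mul (hs.comp measurable_snd)).lintegral_prod_right'
  have ha1 : ∀ x, 1 ≤ a x := by
    intro x
    have h2 : (2 : ℝ≥0∞) ≤ a x + 1 := by
      calc (2 : ℝ≥0∞) ≤ volume (ball x R) := by rwa [Measure.addHaar_ball_center]
        _ = ∫⁻ y in ball x R, 1 := by simp
        _ = ∫⁻ y in ball x R, (s y + r y) := by
            refine lintegral_congr_ae (ae_restrict_of_ae ?_)
            filter_upwards [hrs] with y hy using hy.symm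
        _ = a x + ∫⁻ y in ball x R, r y := by rw [lintegral_add_left hs]; simp only [a, hIball]
        _ ≤ a x + 1 := by gcongr; rw [← hr1]; exact setLIntegral_le_lintegral _ _
    have : (1 : ℝ≥0∞) + 1 ≤ a x + 1 := by rwa [one_add_one_eq_two]
    exact (ENNReal.add_le_add_iff_right ENNReal.one_ne_top).1 this
  have hafin : ∀ x, a x ≠ ⊤ := by
    intro x
    have : a x ≤ volume (ball x R) := by
      calc a x = ∫⁻ y in ball x R, s y := hIball x s
        _ ≤ ∫⁻ y in ball x R, 1 := by
            refine lintegral_mono_ae (ae_restrict_of_ae ?_)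
            filter_upwards [hrs] with y hy
            rw [← hy]; exact le_self_add
        _ = volume (ball x R) := by simp
    exact ne_top_of_le_ne_top measure_ball_lt_top.ne this
  let f : Euc N × Euc N → ℝ≥0∞ := fun z => r z.1 * (a z.1)⁻¹ * (I z * s z.2)
  have hf : Measurable f :=
    ((hr.comp measurable_fst).mul (ha.comp measurable_fst).inv).mul
      (hI.mul (hs.comp measurable_snd))
  let b : Euc N → ℝ≥0∞ := fun y => ∫⁻ x, r x * (a x)⁻¹ * I (x, y)
  have hbm0 : Measurable fun z : Euc N × Euc N => r z.1 * (a z.1)⁻¹ * I z :=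
    ((hr.comp measurable_fst).mul (ha.comp measurable_fst).inv).mul hI
  have hb : Measurable b := hbm0.lintegral_prod_left'
  have hb1 : ∀ y, b y ≤ 1 := by
    intro y
    rw [← hr1]
    refine lintegral_mono fun x => ?_
    calc r x * (a x)⁻¹ * I (x, y) ≤ r x * 1 * 1 := by
          gcongr
          · exact ENNReal.inv_le_one.2 (ha1 x)
          · exact hI1 _
      _ = ENNReal.ofReal (ρ x) := by simp [r]
  let π : Measure (Euc N × Euc N) := (volume.prod volume).withDensity f
  have hπ : ∀ g : Euc N × Euc N → ℝ≥0∞, Measurable g →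
      ∫⁻ z, g z ∂π = ∫⁻ z, f z * g z ∂(volume.prod volume) := fun g hg =>
    lintegral_withDensity_eq_lintegral_mul _ hf hg
  have h1 : π.map Prod.fst = densM volume ρ := by
    refine Measure.ext_of_lintegral _ fun g hg => ?_
    rw [lintegral_map hg measurable_fst, hπ (fun z => g z.1) (hg.comp measurable_fst),
      lintegral_prod (fun z => f z * g z.1) (hf.mul (hg.comp measurable_fst)).aemeasurable]
    have : ∫⁻ x, g x ∂(densM volume ρ) = ∫⁻ x, r x * g x :=
      lintegral_withDensity_eq_lintegral_mul _ hr hg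
    rw [this]
    refine lintegral_congr fun x => ?_
    have e : ∀ y, f (x, y) * g x = (r x * (a x)⁻¹ * g x) * (I (x, y) * s y) := by
      intro y; simp only [f]; ring
    simp only [e]
    rw [lintegral_const_mul _ (show Measurable fun y => I (x, y) * s y from (hI.comp measurable_prodMk_left).mul hs)]
    change r x * (a x)⁻¹ * g x * a x = _
    have : (a x)⁻¹ * a x = 1 := ENNReal.inv_mul_cancel (one_pos.trans_le (ha1 x)).ne' (hafin x)
    calc _ = r x * g x * ((a x)⁻¹ * a x) := by ring
      _ = _ := by rw [this, mul_one]
  let η : Euc N → ℝ := fun y => (s y * b y).toReal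
  have hηof : ∀ y, ENNReal.ofReal (η y) = s y * b y := fun y =>
    ENNReal.ofReal_toReal (ENNReal.mul_ne_top ENNReal.ofReal_ne_top
      (ne_top_of_le_ne_top ENNReal.one_ne_top (hb1 y)))
  have h2 : π.map Prod.snd = densM volume η := by
    refine Measure.ext_of_lintegral _ fun g hg => ?_
    rw [lintegral_map hg measurable_snd, hπ (fun z => g z.2) (hg.comp measurable_snd),
      lintegral_prod_symm' (fun z => f z * g z.2) (hf.mul (hg.comp measurable_snd))]
    have : ∫⁻ x, g x ∂(densM volume η) = ∫⁻ x, s x * b x * g x := by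
      unfold densM
      simp only [hηof]
      exact lintegral_withDensity_eq_lintegral_mul _ (hs.mul hb) hg
    rw [this]
    refine lintegral_congr fun y => ?_
    have e : ∀ x, f (x, y) * g y = (s y * g y) * (r x * (a x)⁻¹ * I (x, y)) := by
      intro x; simp only [f]; ring
    simp only [e]
    rw [lintegral_const_mul _ (show Measurable fun x => r x * (a x)⁻¹ * I (x, y) from hbm0.comp measurable_prodMk_right)]
    change s y * g y * b y = _
    ring
  have hπu : π univ = 1 := by
    have : (π.map Prod.fst) univ = 1 := by
      rw [h1, densM, withDensity_apply _ MeasurableSet.univ, Measure.restrict_univ, hr1]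
    rwa [Measure.map_apply measurable_fst MeasurableSet.univ] at this
  have hadm : Adm volume ρ η := by
    refine ⟨(hs.mul hb).ennreal_toReal, fun x => ENNReal.toReal_nonneg, ?_, ?_⟩
    · filter_upwards [hρ01] with x hx
      have : η x ≤ 1 - ρ x := by
        refine ENNReal.toReal_le_of_le_ofReal (by linarith) ?_
        calc s x * b x ≤ s x * 1 := by gcongr; exact hb1 x
          _ = _ := mul_one _
      linarith
    · rw [hr1, ← hπu]
      have : (π.map Prod.snd) univ = π univ := Measure.map_apply measurable_snd MeasurableSet.univ
      rw [← this, h2, densM, withDensity_apply _ MeasurableSet.univ, Measure.restrict_univ]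
  have hcost : tCost p π ≤ ENNReal.ofReal (R ^ p) := by
    have hC : Measurable fun z : Euc N × Euc N => ENNReal.ofReal (dist z.1 z.2 ^ p) :=
      ENNReal.measurable_ofReal.comp ((measurable_fst.dist measurable_snd).pow_const p)
    calc tCost p π = ∫⁻ z, f z * ENNReal.ofReal (dist z.1 z.2 ^ p) ∂(volume.prod volume) :=
          hπ _ hC
      _ ≤ ∫⁻ z, f z * ENNReal.ofReal (R ^ p) ∂(volume.prod volume) := by
          refine lintegral_mono fun z => ?_
          by_cases h : dist z.1 z.2 < R
          · dsimp only; gcongr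
          · simp [f, I, h]
      _ = ∫⁻ z, ENNReal.ofReal (R ^ p) ∂π := (hπ _ measurable_const).symm
      _ = ENNReal.ofReal (R ^ p) := by rw [lintegral_const, hπu, mul_one]
  refine ne_top_of_le_ne_top ENNReal.ofReal_ne_top (le_trans ?_ hcost)
  exact (iInf₂_le η hadm).trans (iInf₂_le π ⟨h1, h2⟩)

lemma exists_ball {N : ℕ} (h : 2 ≤ volume (univ : Set (Euc N))) :
    ∃ R : ℝ, 2 ≤ volume (ball (0 : Euc N) R) := by
  rcases Nat.eq_zero_or_pos N with rfl | hN
  · refine ⟨1, ?_⟩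
    have : ball (0 : Euc 0) 1 = univ := by
      ext x; simp [Subsingleton.elim x 0]
    rwa [this]
  · have : Nonempty (Fin N) := ⟨⟨0, hN⟩⟩
    have hu : volume (univ : Set (Euc N)) = ⊤ := measure_univ_of_isAddLeftInvariant _
    have ht := tendsto_measure_iUnion_atTop (μ := (volume : Measure (Euc N)))
      (s := fun n : ℕ => ball (0 : Euc N) n)
      (fun i j hij => ball_subset_ball (by exact_mod_cast hij))
    rw [iUnion_ball_nat, hu] at ht
    obtain ⟨n, hn⟩ := (ht.eventually (eventually_ge_nhds (by simp : (2 : ℝ≥0∞) < ⊤))).exists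
    exact ⟨n, hn⟩

lemma isom_equiv {N : ℕ} (F : Euc N → Euc N) (hF : Isometry F) :
    ∃ e : Euc N ≃ᵐ Euc N, ⇑e = F ∧ MeasurePreserving F volume volume := by
  let A := hF.affineIsometryOfStrictConvexSpace
  let L : Euc N ≃ₗᵢ[ℝ] Euc N := A.linearIsometry.toLinearIsometryEquiv rfl
  have hFL : F = fun x => L x + F 0 := by
    funext x
    have := A.map_vadd 0 x
    simpa [A, L] using this
  refine ⟨(A.toAffineIsometryEquiv rfl).toHomeomorph.toMeasurableEquiv, ?_, ?_⟩
  · funext x; simp [A]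
  · rw [hFL]
    exact (measurePreserving_add_right volume (F 0)).comp L.measurePreserving

lemma map_densM {N : ℕ} (F : Euc N → Euc N) (e : Euc N ≃ᵐ Euc N) (he : ⇑e = F)
    (hmp : MeasurePreserving F volume volume) (η : Euc N → ℝ) (hη : Measurable η) :
    (densM volume η).map F = densM volume (fun x => η (e.symm x)) := by
  refine Measure.ext_of_lintegral _ fun g hg => ?_
  rw [lintegral_map hg hmp.measurable]
  have hη1 : Measurable fun x => ENNReal.ofReal (η x) := ENNReal.measurable_ofReal.comp hη
  have hη2 : Measurable fun x => ENNReal.ofReal (η (e.symm x)) := hη1.comp e.symm.measurable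
  have e1 : ∫⁻ x, g (F x) ∂(densM volume η) = ∫⁻ x, ENNReal.ofReal (η x) * g (F x) :=
    lintegral_withDensity_eq_lintegral_mul _ hη1 (hg.comp hmp.measurable)
  have e2 : ∫⁻ x, g x ∂(densM volume fun x => η (e.symm x)) =
      ∫⁻ x, ENNReal.ofReal (η (e.symm x)) * g x :=
    lintegral_withDensity_eq_lintegral_mul _ hη2 hg
  have e3 : ∫⁻ x, ENNReal.ofReal (η (e.symm (F x))) * g (F x) =
      ∫⁻ x, ENNReal.ofReal (η (e.symm x)) * g x := hmp.lintegral_comp (hη2.mul hg)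
  rw [e1, e2, ← e3]
  refine lintegral_congr fun x => ?_
  simp only [← he, MeasurableEquiv.symm_apply_apply]

/-- Symmetries of the transport problem: if an isometry `F` preserves `ρℒ^N`, then it
preserves the optimal density `η_ρℒ^N` and the optimal plan `π_ρ` (via `F̃(x,y) = (F x, F y)`). -/
theorem symmetry_of_transport {N : ℕ} (p : ℝ) (hp : 1 < p)
    (ρ : Euc N → ℝ) (hρ : memA volume 1 ρ)
    (F : Euc N → Euc N) (hF : Isometry F)
    (hFρ : Measure.map F (densM volume ρ) = densM volume ρ)
    (η : Euc N → ℝ) (hη : Adm volume ρ η)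
    (hη_opt : WpPow p (densM volume ρ) (densM volume η) = WEnergyPow p volume ρ)
    (π : Measure (Euc N × Euc N)) (hπ : IsCoupling π (densM volume ρ) (densM volume η))
    (hπ_opt : tCost p π = WpPow p (densM volume ρ) (densM volume η)) :
    Measure.map F (densM volume η) = densM volume η ∧
    Measure.map (fun z : Euc N × Euc N => (F z.1, F z.2)) π = π := by
  obtain ⟨e, he, hmp⟩ := isom_equiv F hF
  obtain ⟨hρm, hρ01, hρ1⟩ := id hρ
  obtain ⟨hηm, hη0, hρη, hηmass⟩ := id hη
  have hFm : Measurable F := hmp.measurable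
  have hr : Measurable fun x => ENNReal.ofReal (ρ x) := ENNReal.measurable_ofReal.comp hρm
  have hρint : Integrable ρ := by
    by_contra h
    rw [integral_undef h] at hρ1
    norm_num at hρ1
  have hr1 : ∫⁻ x, ENNReal.ofReal (ρ x) = 1 := by
    rw [← ofReal_integral_eq_lintegral_ofReal hρint (hρ01.mono fun x hx => hx.1), hρ1]
    simp
  -- finiteness
  have hu : 2 ≤ volume (univ : Set (Euc N)) := by
    calc (2 : ℝ≥0∞) = (∫⁻ x, ENNReal.ofReal (ρ x)) + ∫⁻ x, ENNReal.ofReal (η x) := by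
          rw [hηmass, hr1, one_add_one_eq_two]
      _ = ∫⁻ x, (ENNReal.ofReal (ρ x) + ENNReal.ofReal (η x)) := (lintegral_add_left hr _).symm
      _ ≤ ∫⁻ _ : Euc N, 1 := by
          refine lintegral_mono_ae ?_
          filter_upwards [hρ01, hρη] with x h1 h2
          rw [← ENNReal.ofReal_add h1.1 (hη0 x)]
          exact ENNReal.ofReal_le_one.2 h2
      _ = _ := by simp
  obtain ⟨R, hR⟩ := exists_ball hu
  have hfin := energy_fin p hp ρ hρ hr1 R hR
  have hπE : tCost p π = WEnergyPow p volume ρ := hπ_opt.trans hη_opt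
  -- the transported density
  have hemp : MeasurePreserving e.symm volume volume := by
    have : MeasurePreserving e volume volume := by rw [he]; exact hmp
    exact this.symm e
  have hρe : ∀ᵐ x, ρ (e.symm x) = ρ x := by
    have h1 := map_densM F e he hmp ρ hρm
    rw [hFρ] at h1
    have h2 := (withDensity_eq_iff hr.aemeasurable
      (hr.comp e.symm.measurable).aemeasurable (by rw [hr1]; simp)).1 h1
    filter_upwards [h2, hρ01, hemp.quasiMeasurePreserving.ae hρ01] with x h3 h4 h5
    have h3' : ENNReal.ofReal (ρ x) = ENNReal.ofReal (ρ (e.symm x)) := h3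
    exact ((ENNReal.ofReal_eq_ofReal_iff h4.1 h5.1).1 h3').symm
  let η' : Euc N → ℝ := fun x => η (e.symm x)
  have hη'm : Measurable η' := hηm.comp e.symm.measurable
  have hη'0 : ∀ x, 0 ≤ η' x := fun x => hη0 _
  have hmapη : (densM volume η).map F = densM volume η' := map_densM F e he hmp η hηm
  have hρη' : ∀ᵐ x, ρ x + η' x ≤ 1 := by
    filter_upwards [hρe, hemp.quasiMeasurePreserving.ae hρη] with x h1 h2
    rw [← h1]; exact h2
  have ho : Measurable fun x => ENNReal.ofReal (η x) := ENNReal.measurable_ofReal.comp hηm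
  have hmass' : ∫⁻ x, ENNReal.ofReal (η' x) = 1 := by
    rw [← hr1, ← hηmass]
    exact hemp.lintegral_comp ho
  let θ : Euc N → ℝ := fun x => 2⁻¹ * (η x + η' x)
  have hθof : ∀ x, ENNReal.ofReal (θ x) =
      (2⁻¹ : ℝ≥0∞) * (ENNReal.ofReal (η x) + ENNReal.ofReal (η' x)) := by
    intro x
    simp only [θ]
    rw [ENNReal.ofReal_mul (by norm_num), ENNReal.ofReal_add (hη0 x) (hη'0 x),
      ENNReal.ofReal_inv_of_pos (by norm_num), ENNReal.ofReal_ofNat]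
  have half : ∀ c : ℝ≥0∞, (2⁻¹ : ℝ≥0∞) * (c + c) = c := by
    intro c
    rw [← two_mul, ← mul_assoc, ENNReal.inv_mul_cancel (by simp) (by simp), one_mul]
  have ho' : Measurable fun x => ENNReal.ofReal (η' x) := ENNReal.measurable_ofReal.comp hη'm
  have hθadm : Adm volume ρ θ := by
    refine ⟨(hηm.add hη'm).const_mul _, fun x => ?_, ?_, ?_⟩
    · have := hη0 x
      have := hη'0 x
      simp only [θ]; positivity
    · filter_upwards [hρη, hρη'] with x h1 h2
      simp only [θ]; linarith
    · simp only [hθof]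
      rw [lintegral_const_mul _ (show Measurable fun x => ENNReal.ofReal (η x) + ENNReal.ofReal (η' x)
        from ho.add ho'), lintegral_add_left ho, hmass', hηmass, hr1, half]
  have hθM : densM volume θ = (2⁻¹ : ℝ≥0∞) • (densM volume η + densM volume η') := by
    unfold densM
    simp only [hθof]
    rw [← withDensity_add_left ho, ← withDensity_smul _ (ho.add ho')]
    rfl
  -- the transported plan
  set G : Euc N × Euc N → Euc N × Euc N := fun z => (F z.1, F z.2) with hG
  have hGm : Measurable G := (hFm.comp measurable_fst).prodMk (hFm.comp measurable_snd)
  set π' := π.map G with hπ'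
  have hf' : π'.map Prod.fst = densM volume ρ := by
    rw [hπ', Measure.map_map measurable_fst hGm, ← hFρ, ← hπ.1, Measure.map_map hFm measurable_fst]
    rfl
  have hs' : π'.map Prod.snd = densM volume η' := by
    rw [hπ', Measure.map_map measurable_snd hGm, ← hmapη, ← hπ.2, Measure.map_map hFm measurable_snd]
    rfl
  have hC : Measurable fun z : Euc N × Euc N => ENNReal.ofReal (dist z.1 z.2 ^ p) :=
    ENNReal.measurable_ofReal.comp ((measurable_fst.dist measurable_snd).pow_const p)
  have hcost' : tCost p π' = tCost p π := by
    unfold tCost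
    rw [hπ', lintegral_map hC hGm]
    simp only [hG, hF.dist_eq]
  have uni : ∀ ν : Measure (Euc N × Euc N), ν.map Prod.fst = densM volume ρ → ν univ = 1 := by
    intro ν hν
    have : (ν.map Prod.fst) univ = 1 := by
      rw [hν, densM, withDensity_apply _ MeasurableSet.univ, Measure.restrict_univ, hr1]
    rwa [Measure.map_apply measurable_fst MeasurableSet.univ] at this
  let m : Measure (Euc N × Euc N) := (2⁻¹ : ℝ≥0∞) • (π + π')
  have hm1 : m.map Prod.fst = densM volume ρ := by
    ext A hA
    simp only [m, Measure.map_smul, Measure.map_add _ _ measurable_fst, hf', hπ.1,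
      Measure.smul_apply, Measure.add_apply, smul_eq_mul, half]
  have hm2 : m.map Prod.snd = densM volume θ := by
    simp only [m, Measure.map_smul, Measure.map_add _ _ measurable_snd, hs', hπ.2, hθM]
  have hmp1 : IsProbabilityMeasure m := ⟨uni m hm1⟩
  have hmcost : tCost p m = tCost p π := by
    have : tCost p m = (2⁻¹ : ℝ≥0∞) * (tCost p π + tCost p π') := by
      simp only [tCost, m, lintegral_smul_measure, lintegral_add_measure, smul_eq_mul]
    rw [this, hcost', half]
  have hsw := swap_mono p m (fun m' h1 h2 => by
    rw [hmcost, hπE]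
    exact (iInf₂_le θ hθadm).trans (iInf₂_le m' ⟨h1.trans hm1, h2.trans hm2⟩))
    (by rw [hmcost, hπE]; exact hfin)
  have hnull := graph_null p hp m.support Measure.isClosed_support (supp_mono p hp m hsw)
  have hms : m m.supportᶜ = 0 := Measure.measure_compl_support
  have hz : π m.supportᶜ = 0 ∧ π' m.supportᶜ = 0 := by
    have h0 : (2⁻¹ : ℝ≥0∞) * (π m.supportᶜ + π' m.supportᶜ) = 0 := hms
    simpa using h0
  have hfinal : π = π' := eq_of_graph m.support Measure.isClosed_support hnull π π' hz.1 hz.2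
    (hπ.1.trans hf'.symm) (by rw [hπ.1]; exact withDensity_absolutelyContinuous _ _)
  refine ⟨?_, hfinal.symm⟩
  rw [hmapη, ← hs', ← hfinal, hπ.2]
end
end

section
/- Let ρ, η: ℝ^N → [0,∞) be integrable densities and let T: ℝ^N → ℝ^N be a Borel map with T_#(ρℒ^N) = ηℒ^N which is radial, i.e., for a.e. x ≠ 0 one has T(x) = |T(x)|·x/|x|. For ω ∈ S^{N−1} define ρ^ω(r) = ρ(rω), η^ω(r) = η(rω), T^ω(r) = |T(rω)| for r>0. Then for H^{N−1}-almost every ω ∈ S^{N−1}, the one-dimensional push-forward identity (T^ω)_#(ρ^ω(r) r^{N−1} dr) = η^ω(r) r^{N−1} dr holds as measures on (0,∞). -/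
open MeasureTheory ENNReal Set Metric Filter

noncomputable section

theorem polar_lintegral {N : ℕ} (hN : 1 ≤ N) (f : Euc N → ℝ≥0∞) (hf : Measurable f) :
    ∫⁻ x, f x = ∫⁻ ω, (∫⁻ r in Set.Ioi (0 : ℝ),
      f (r • (ω : Euc N)) * ENNReal.ofReal (r ^ (N - 1)))
      ∂((volume : Measure (Euc N)).toSphere) := by
  have : Nonempty (Fin N) := ⟨⟨0, hN⟩⟩
  have hmp := (volume : Measure (Euc N)).measurePreserving_homeomorphUnitSphereProd
  have h1 : ∫⁻ x, f x = ∫⁻ x : ({(0 : Euc N)}ᶜ : Set (Euc N)), f x.1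
      ∂((volume : Measure (Euc N)).comap (↑)) := by
    rw [lintegral_subtype_comap (measurableSet_singleton _).compl f, restrict_compl_singleton]
  have hg : Measurable (fun p : Metric.sphere (0 : Euc N) 1 × Set.Ioi (0 : ℝ) =>
      f (p.2.1 • (p.1 : Euc N))) := by fun_prop
  have h2 := hmp.lintegral_comp hg
  rw [h1]
  have h3 : ∀ x : ({(0 : Euc N)}ᶜ : Set (Euc N)),
      ((homeomorphUnitSphereProd (Euc N) x).2.1 •
        ((homeomorphUnitSphereProd (Euc N) x).1 : Euc N)) = x.1 := by
    intro x
    have hx : ‖x.1‖ ≠ 0 := norm_ne_zero_iff.2 x.2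
    simp [smul_smul, hx]
  simp only [h3] at h2
  rw [h2, lintegral_prod _ hg.aemeasurable]
  refine lintegral_congr fun ω => ?_
  have hω : Measurable (fun r : ℝ => f (r • (ω : Euc N))) := by fun_prop
  rw [Measure.volumeIoiPow, lintegral_withDensity_eq_lintegral_mul _ (by fun_prop) (by fun_prop)]
  simp only [finrank_euclideanSpace, Fintype.card_fin, Pi.mul_apply]
  rw [lintegral_subtype_comap measurableSet_Ioi
    (fun r : ℝ => ENNReal.ofReal (r ^ (N - 1)) * f (r • (ω : Euc N)))]
  simp only [mul_comm]

/-- Polar factorization of a radial transport map: if `T` is radial and pushes `ρℒ^N`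
to `ηℒ^N`, then for a.e. direction `ω` on the unit sphere the one-dimensional map
`T^ω(r) = |T(rω)|` pushes `ρ(rω) r^{N-1} dr` forward to `η(rω) r^{N-1} dr` on `(0,∞)`. -/
theorem radial_map_factorization {N : ℕ} (hN : 1 ≤ N)
    (ρ η : Euc N → ℝ) (hρ_meas : Measurable ρ) (hη_meas : Measurable η)
    (hρ_nonneg : ∀ x, 0 ≤ ρ x) (hη_nonneg : ∀ x, 0 ≤ η x)
    (hρ_int : Integrable ρ) (hη_int : Integrable η)
    (T : Euc N → Euc N) (hT_meas : Measurable T)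
    (hT_push : Measure.map T (densM volume ρ) = densM volume η)
    (hT_radial : ∀ᵐ x : Euc N, x ≠ 0 → T x = (‖T x‖ / ‖x‖) • x) :
    ∀ᵐ (ω : Metric.sphere (0 : Euc N) 1) ∂((volume : Measure (Euc N)).toSphere),
      Measure.map (fun r : ℝ => ‖T (r • (ω : Euc N))‖)
        ((volume.restrict (Set.Ioi (0 : ℝ))).withDensity
          fun r => ENNReal.ofReal (ρ (r • (ω : Euc N)) * r ^ (N - 1))) =
      (volume.restrict (Set.Ioi (0 : ℝ))).withDensity
        (fun r => ENNReal.ofReal (η (r • (ω : Euc N)) * r ^ (N - 1))) := by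
  have : Nonempty (Fin N) := ⟨⟨0, hN⟩⟩
  set σ := (volume : Measure (Euc N)).toSphere with hσ
  set F : Set ℝ → Metric.sphere (0 : Euc N) 1 → ℝ≥0∞ := fun B ω =>
    ∫⁻ r in Set.Ioi (0 : ℝ), (B.indicator 1 ‖T (r • (ω : Euc N))‖ *
      ENNReal.ofReal (ρ (r • (ω : Euc N)))) * ENNReal.ofReal (r ^ (N - 1)) with hF
  set G : Set ℝ → Metric.sphere (0 : Euc N) 1 → ℝ≥0∞ := fun B ω =>
    ∫⁻ r in Set.Ioi (0 : ℝ), (B.indicator 1 ‖r • (ω : Euc N)‖ *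
      ENNReal.ofReal (η (r • (ω : Euc N)))) * ENNReal.ofReal (r ^ (N - 1)) with hG
  have hind : ∀ {B : Set ℝ}, MeasurableSet B → Measurable (B.indicator (1 : ℝ → ℝ≥0∞)) :=
    fun hB => measurable_one.indicator hB
  have hFm : ∀ B, MeasurableSet B → Measurable (F B) := by
    intro B hB
    have := hind hB
    refine Measurable.lintegral_prod_right' (f := fun p : Metric.sphere (0 : Euc N) 1 × ℝ =>
      (B.indicator 1 ‖T (p.2 • (p.1 : Euc N))‖ *
      ENNReal.ofReal (ρ (p.2 • (p.1 : Euc N)))) * ENNReal.ofReal (p.2 ^ (N - 1))) ?_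
    fun_prop
  have hGm : ∀ B, MeasurableSet B → Measurable (G B) := by
    intro B hB
    have := hind hB
    refine Measurable.lintegral_prod_right' (f := fun p : Metric.sphere (0 : Euc N) 1 × ℝ =>
      (B.indicator 1 ‖p.2 • (p.1 : Euc N)‖ *
      ENNReal.ofReal (η (p.2 • (p.1 : Euc N)))) * ENNReal.ofReal (p.2 ^ (N - 1))) ?_
    fun_prop
  -- a.e. facts under the density measure
  have hT0 : ∀ᵐ x ∂(densM volume ρ), T x ≠ 0 := by
    have h0 : densM volume η {(0 : Euc N)} = 0 :=
      (withDensity_absolutelyContinuous _ _) (measure_singleton _)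
    rw [← hT_push, Measure.map_apply hT_meas (measurableSet_singleton _)] at h0
    exact measure_eq_zero_iff_ae_notMem.1 h0
  have hTr : ∀ᵐ x ∂(densM volume ρ), x ≠ 0 → T x = (‖T x‖ / ‖x‖) • x :=
    (withDensity_absolutelyContinuous _ _).ae_le hT_radial
  have hx0 : ∀ᵐ x ∂(densM volume ρ), x ≠ 0 := by
    refine (withDensity_absolutelyContinuous _ _).ae_le ?_
    exact measure_eq_zero_iff_ae_notMem.1 (measure_singleton (0 : Euc N))
  have hcone : ∀ (A' : Set (Euc N)) (ω : Metric.sphere (0 : Euc N) 1) (r : ℝ), 0 < r →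
      A'.indicator (1 : Euc N → ℝ≥0∞) (‖r • (ω : Euc N)‖⁻¹ • (r • (ω : Euc N)))
        = A'.indicator 1 (ω : Euc N) := by
    intro A' ω r hr
    have : ‖r • (ω : Euc N)‖⁻¹ • (r • (ω : Euc N)) = ω := by
      simp [norm_smul, smul_smul, abs_of_pos hr, hr.ne']
    rw [this]
  have hset : ∀ B, MeasurableSet B → F B =ᵐ[σ] G B := by
    intro B hB
    refine ae_eq_of_forall_setLIntegral_eq_of_sigmaFinite (hFm B hB) (hGm B hB) ?_
    rintro A ⟨A', hA', rfl⟩ -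
    have hiB := hind hB
    have hiA : Measurable (A'.indicator (1 : Euc N → ℝ≥0∞)) := measurable_one.indicator hA'
    have key : ∫⁻ x, A'.indicator 1 (‖x‖⁻¹ • x) * B.indicator 1 ‖T x‖ * ENNReal.ofReal (ρ x)
        = ∫⁻ x : Euc N, A'.indicator 1 (‖x‖⁻¹ • x) * B.indicator 1 ‖x‖ * ENNReal.ofReal (η x) := by
      have e1 : ∫⁻ x, A'.indicator 1 (‖x‖⁻¹ • x) * B.indicator 1 ‖T x‖ * ENNReal.ofReal (ρ x)
          = ∫⁻ x, A'.indicator 1 (‖x‖⁻¹ • x) * B.indicator 1 ‖T x‖ ∂(densM volume ρ) := by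
        rw [densM, lintegral_withDensity_eq_lintegral_mul _ (by fun_prop) (by fun_prop)]
        simp only [Pi.mul_apply, mul_comm]
      have e2 : ∫⁻ x : Euc N,
            A'.indicator 1 (‖x‖⁻¹ • x) * B.indicator 1 ‖x‖ * ENNReal.ofReal (η x)
          = ∫⁻ x, A'.indicator 1 (‖x‖⁻¹ • x) * B.indicator 1 ‖x‖ ∂(densM volume η) := by
        rw [densM, lintegral_withDensity_eq_lintegral_mul _ (by fun_prop) (by fun_prop)]
        simp only [Pi.mul_apply, mul_comm]
      rw [e1, e2, ← hT_push, lintegral_map (by fun_prop) hT_meas]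
      refine lintegral_congr_ae ?_
      filter_upwards [hT0, hTr, hx0] with x h1 h2 h3
      have h4 := h2 h3
      have h5 : ‖T x‖⁻¹ • T x = ‖x‖⁻¹ • x := by
        have h6 : ‖T x‖ ≠ 0 := norm_ne_zero_iff.2 h1
        calc ‖T x‖⁻¹ • T x = ‖T x‖⁻¹ • ((‖T x‖ / ‖x‖) • x) := by rw [← h4]
          _ = ‖x‖⁻¹ • x := by
            rw [smul_smul]; congr 1; field_simp
      simp only [h5]
    rw [polar_lintegral hN _ (by fun_prop), polar_lintegral hN _ (by fun_prop)] at key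
    have hm : MeasurableSet (Subtype.val ⁻¹' A' : Set (Metric.sphere (0 : Euc N) 1)) :=
      measurable_subtype_coe hA'
    have e3 : ∀ (H : Metric.sphere (0 : Euc N) 1 → ℝ≥0∞),
        ∫⁻ ω in Subtype.val ⁻¹' A', H ω ∂σ = ∫⁻ ω, A'.indicator 1 (ω : Euc N) * H ω ∂σ := by
      intro H
      rw [← lintegral_indicator hm]
      refine lintegral_congr fun ω => ?_
      by_cases h : (ω : Euc N) ∈ A' <;> simp [h]
    rw [e3, e3]
    refine Eq.trans ?_ (key.trans ?_)
    · refine lintegral_congr fun ω => ?_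
      rw [hF, ← lintegral_const_mul _ (by fun_prop)]
      refine setLIntegral_congr_fun measurableSet_Ioi fun r hr => ?_
      simp only [hcone A' ω r hr, mul_assoc]
    · refine lintegral_congr fun ω => ?_
      rw [hG, ← lintegral_const_mul _ (by fun_prop)]
      refine setLIntegral_congr_fun measurableSet_Ioi fun r hr => ?_
      simp only [hcone A' ω r hr, mul_assoc]
  have hfin : ∀ᵐ ω ∂σ, F univ ω < ∞ := by
    refine ae_lt_top (hFm _ .univ) ?_
    have hp := polar_lintegral hN (fun x => ENNReal.ofReal (ρ x)) (by fun_prop)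
    have : ∫⁻ ω, F univ ω ∂σ = ∫⁻ x, ENNReal.ofReal (ρ x) := by
      rw [hp]; simp [hF, hσ]
    rw [this]
    exact hρ_int.lintegral_lt_top.ne
  have hall : ∀ᵐ ω ∂σ, ∀ a b : ℚ, F (Ioo (a : ℝ) b) ω = G (Ioo (a : ℝ) b) ω := by
    rw [ae_all_iff]; intro a
    rw [ae_all_iff]; intro b
    exact hset _ measurableSet_Ioo
  filter_upwards [hfin, hall] with ω h1 h2
  have hTω : Measurable (fun r : ℝ => ‖T (r • (ω : Euc N))‖) := by fun_prop
  have hL : ∀ B, MeasurableSet B → Measure.map (fun r : ℝ => ‖T (r • (ω : Euc N))‖)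
        ((volume.restrict (Set.Ioi (0 : ℝ))).withDensity
          fun r => ENNReal.ofReal (ρ (r • (ω : Euc N)) * r ^ (N - 1))) B = F B ω := by
    intro B hB
    rw [Measure.map_apply hTω hB, withDensity_apply _ (hTω hB), hF,
      ← lintegral_indicator (hTω hB)]
    refine lintegral_congr fun r => ?_
    by_cases h : ‖T (r • (ω : Euc N))‖ ∈ B <;>
      simp [indicator, h, ENNReal.ofReal_mul (hρ_nonneg _)]
  have hR : ∀ B, MeasurableSet B → ((volume.restrict (Set.Ioi (0 : ℝ))).withDensity
        (fun r => ENNReal.ofReal (η (r • (ω : Euc N)) * r ^ (N - 1)))) B = G B ω := by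
    intro B hB
    rw [withDensity_apply _ hB, hG, ← lintegral_indicator hB]
    refine setLIntegral_congr_fun measurableSet_Ioi fun r hr => ?_
    have hr' : ‖r • (ω : Euc N)‖ = r := by
      simp [norm_smul, abs_of_pos (mem_Ioi.1 hr)]
    simp only [hr']
    by_cases h : r ∈ B <;> simp [h, ENNReal.ofReal_mul (hη_nonneg _)]
  have : IsFiniteMeasure (Measure.map (fun r : ℝ => ‖T (r • (ω : Euc N))‖)
        ((volume.restrict (Set.Ioi (0 : ℝ))).withDensity
          fun r => ENNReal.ofReal (ρ (r • (ω : Euc N)) * r ^ (N - 1)))) :=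
    ⟨by rw [hL _ .univ]; exact h1⟩
  refine Real.measure_ext_Ioo_rat fun a b => ?_
  rw [hL _ measurableSet_Ioo, hR _ measurableSet_Ioo]
  exact h2 a b
end
end
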